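/- arXiv:2205.13893 — 2 statements merged into one kernel-verified Lean document; each statement's English description precedes it below -/
import Mathlib

section
/- Decompose ℝⁿ = ℝ^{k_1} × ℝ^{k_2} × … × ℝ^{k_i} × ℝ^{n − Σ_j k_j} with n ≥ k_1+…+k_i, and let r_1 = √(x_1²+…+x_{k_1}²), r_2 = √(x_{k_1+1}²+…+x_{k_1+k_2}²), …, r_i the Euclidean norm of the i-th consecutive group of k_i coordinates. Let 0<p,q≤∞, and for each 1≤j≤i let p⃗_j, q⃗_j be exponent vectors of length k_j with 1<(p⃗_j)_ℓ<∞, 1≤(q⃗_j)_ℓ≤∞, and let 0<α_j<k_j/(p⃗_j)_ℓ for all 1≤ℓ≤k_j. Then there exists a constant C>0 such that for all f ∈ C_0^∞(ℝⁿ), ‖ f / ∏_{j=1}^{i} r_j^{α_j} ‖_{L^{p⃗_1,q⃗_1}(ℝ^{k_1}) ⋯ L^{p⃗_i,q⃗_i}(ℝ^{k_i}) L^{p,q}(ℝ^{n−Σ_j k_j})} ≤ C ‖ Λ_{x_1,…,x_{Σ_j k_j}}^{α_1+…+α_i} f ‖_{L^{p⃗_1,q⃗_1}(ℝ^{k_1})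 ⋯ L^{p⃗_i,q⃗_i}(ℝ^{k_i}) L^{p,q}(ℝ^{n−Σ_j k_j})}, where the iterated norm takes mixed Lorentz norms group by group (innermost in the first group of variables). -/
open MeasureTheory ENNReal Real Set

noncomputable section

/-- The decreasing rearrangement of an `ℝ≥0∞`-valued function. -/
def rearr {α : Type*} [MeasurableSpace α] (μ : Measure α) (f : α → ℝ≥0∞) (t : ℝ) : ℝ≥0∞ :=
  sInf {s : ℝ≥0∞ | μ {x | s < f x} ≤ ENNReal.ofReal t}

/-- The Lorentz `L^{p,q}` quasi-norm, `‖f‖_{p,q} = ‖ t^{1/p} f*(t) ‖_{L^q((0,∞),dt/t)}`,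
with `q = ∞` giving the weak-`L^p` quasi-norm. -/
def lorentzNorm {α : Type*} [MeasurableSpace α] (μ : Measure α) (p q : ℝ≥0∞)
    (f : α → ℝ≥0∞) : ℝ≥0∞ :=
  if q = ∞ then ⨆ t ∈ Set.Ioi (0 : ℝ), ENNReal.ofReal t ^ p⁻¹.toReal * rearr μ f t
  else (∫⁻ t in Set.Ioi (0 : ℝ),
      (ENNReal.ofReal t ^ p⁻¹.toReal * rearr μ f t) ^ q.toReal / ENNReal.ofReal t) ^ q⁻¹.toReal

/-- Mixed (anisotropic) Lorentz quasi-norm on `ℝⁿ`: the Lorentz quasi-norm is taken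
iteratively in each coordinate, with the coordinate `x 0` innermost. -/
def mixedLorentz : (n : ℕ) → (Fin n → ℝ≥0∞) → (Fin n → ℝ≥0∞) →
    ((Fin n → ℝ) → ℝ≥0∞) → ℝ≥0∞
  | 0, _, _, f => f (fun i => i.elim0)
  | n + 1, p, q, f => mixedLorentz n (fun i => p i.succ) (fun i => q i.succ)
      (fun y => lorentzNorm (volume : Measure ℝ) (p 0) (q 0) (fun x => f (Fin.cons x y)))

/-- Mixed (anisotropic) Lebesgue norm on `ℝⁿ`, coordinate `x 0` innermost. -/
def mixedLp : (n : ℕ) → (Fin n → ℝ) → ((Fin n → ℝ) → ℝ≥0∞) → ℝ≥0∞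
  | 0, _, f => f (fun i => i.elim0)
  | n + 1, p, f => mixedLp n (fun i => p i.succ)
      (fun y => (∫⁻ x : ℝ, (f (Fin.cons x y)) ^ (p 0)) ^ (1 / p 0))

/-- The Fourier transform on `ℝⁿ`, normalized as `(2π)^{-n/2} ∫ f(x) e^{-i ξ·x} dx`. -/
def ft (n : ℕ) (f : (Fin n → ℝ) → ℂ) (ξ : Fin n → ℝ) : ℂ :=
  (((2 * π) ^ (-(n : ℝ) / 2) : ℝ) : ℂ) *
    ∫ x : Fin n → ℝ, Complex.exp (-(Complex.I * ((∑ i, ξ i * x i : ℝ) : ℂ))) * f x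

/-- `Λ^s` acting only in the coordinates of `S`: the Fourier multiplier with symbol
`(∑_{i ∈ S} |ξ i|²)^{s/2}`. -/
def fracLapOn (n : ℕ) (S : Finset (Fin n)) (s : ℝ) (f : (Fin n → ℝ) → ℂ)
    (x : Fin n → ℝ) : ℂ :=
  ft n (fun ξ => ((((∑ i ∈ S, ξ i ^ 2) ^ (s / 2) : ℝ)) : ℂ) * ft n f ξ) (-x)

/-- The fractional Laplacian `Λ^s = (−Δ)^{s/2}`. -/
def fracLap (n : ℕ) (s : ℝ) (f : (Fin n → ℝ) → ℂ) : (Fin n → ℝ) → ℂ :=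
  fracLapOn n Finset.univ s f


noncomputable section

/-- The structured domain `ℝ^{k_1} × ⋯ × ℝ^{k_i} × ℝ^m`. -/
abbrev GrpDom (i : ℕ) (k : Fin i → ℕ) (m : ℕ) : Type :=
  (∀ j : Fin i, Fin (k j) → ℝ) × (Fin m → ℝ)

/-- Iterated mixed Lorentz norm over the groups of coordinates, the first group innermost;
within each group the mixed Lorentz norm is taken coordinate by coordinate. -/
def grpNorm : (i : ℕ) → (k : Fin i → ℕ) →
    (P : (j : Fin i) → Fin (k j) → ℝ≥0∞) → (Q : (j : Fin i) → Fin (k j) → ℝ≥0∞) →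
    ((∀ j : Fin i, Fin (k j) → ℝ) → ℝ≥0∞) → ℝ≥0∞
  | 0, _, _, _, f => f (fun j => j.elim0)
  | i + 1, k, P, Q, f => grpNorm i (fun j => k j.succ) (fun j => P j.succ) (fun j => Q j.succ)
      (fun ys => mixedLorentz (k 0) (P 0) (Q 0) (fun x => f (Fin.cons x ys)))

/-- The full iterated norm `L^{p⃗_1,q⃗_1}(ℝ^{k_1}) ⋯ L^{p⃗_i,q⃗_i}(ℝ^{k_i}) L^{p,q}(ℝ^m)`:
mixed Lorentz norms group by group (first group innermost), followed by the
(multivariate) Lorentz `L^{p,q}` norm over the last factor `ℝ^m`. -/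
def grpFullNorm (i : ℕ) (k : Fin i → ℕ) (m : ℕ)
    (P Q : (j : Fin i) → Fin (k j) → ℝ≥0∞) (p q : ℝ≥0∞)
    (f : GrpDom i k m → ℝ≥0∞) : ℝ≥0∞ :=
  lorentzNorm (volume : Measure (Fin m → ℝ)) p q
    (fun z => grpNorm i k P Q (fun ys => f (ys, z)))

/-- The Fourier transform on the structured domain. -/
def grpFt (i : ℕ) (k : Fin i → ℕ) (m : ℕ) (f : GrpDom i k m → ℂ) (ξ : GrpDom i k m) : ℂ :=
  (((2 * π) ^ (-((((∑ j, k j) + m : ℕ)) : ℝ) / 2) : ℝ) : ℂ) *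
    ∫ x : GrpDom i k m,
      Complex.exp (-(Complex.I *
        (((∑ j, ∑ ℓ, ξ.1 j ℓ * x.1 j ℓ) + ∑ a, ξ.2 a * x.2 a : ℝ) : ℂ))) * f x

/-- `Λ^s` acting only in the first `k_1 + ⋯ + k_i` coordinates of the structured domain:
the Fourier multiplier with symbol `(∑_j ∑_ℓ |ξ_{jℓ}|²)^{s/2}`. -/
def grpFracLap (i : ℕ) (k : Fin i → ℕ) (m : ℕ) (s : ℝ) (f : GrpDom i k m → ℂ)
    (x : GrpDom i k m) : ℂ :=
  grpFt i k m
    (fun ξ => ((((∑ j, ∑ ℓ, ξ.1 j ℓ ^ 2) ^ (s / 2) : ℝ)) : ℂ) * grpFt i k m f ξ) (-x)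




/-- Minkowski's integral inequality, `ℝ≥0∞` version. -/
theorem mink_lintegral {T X : Type*} [MeasurableSpace T] [MeasurableSpace X]
    (μ : Measure T) [SFinite μ] (ν : Measure X) [SigmaFinite ν] (q : ℝ) (hq : 1 ≤ q)
    (F : T → X → ℝ≥0∞) (hF : Measurable (Function.uncurry F)) :
    (∫⁻ x, (∫⁻ t, F t x ∂μ) ^ q ∂ν) ^ (1 / q) ≤ ∫⁻ t, (∫⁻ x, (F t x) ^ q ∂ν) ^ (1 / q) ∂μ := by
  rcases eq_or_lt_of_le hq with h1 | h1
  · subst h1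
    simp only [ENNReal.rpow_one, div_one]
    rw [lintegral_lintegral_swap]
    exact (hF.comp measurable_swap).aemeasurable
  have hq0 : 0 < q := by linarith
  set H : X → ℝ≥0∞ := fun x => ∫⁻ t, F t x ∂μ with hH
  have hHm : Measurable H := Measurable.lintegral_prod_left hF
  set R := ∫⁻ t, (∫⁻ x, (F t x) ^ q ∂ν) ^ (1 / q) ∂μ with hR
  -- truncations
  set S := spanningSets ν
  let Hn : ℕ → X → ℝ≥0∞ := fun n => (S n).indicator (fun x => min (H x) n)
  have hHnm : ∀ n, Measurable (Hn n) := fun n =>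
    (hHm.min measurable_const).indicator (measurableSet_spanningSets ν n)
  have hHnle : ∀ n x, Hn n x ≤ H x := by
    intro n x
    simp only [Hn, indicator]
    split_ifs
    · exact min_le_left _ _
    · exact zero_le
  have hfin : ∀ n, ∫⁻ x, Hn n x ^ q ∂ν ≠ ∞ := by
    intro n
    have : ∫⁻ x, Hn n x ^ q ∂ν ≤ ∫⁻ x, (S n).indicator (fun _ => (n : ℝ≥0∞) ^ q) x ∂ν := by
      apply lintegral_mono
      intro x
      simp only [Hn, indicator]
      split_ifs
      · exact ENNReal.rpow_le_rpow (min_le_right _ _) hq0.le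
      · simp [hq0]
    refine ne_top_of_le_ne_top ?_ this
    rw [lintegral_indicator_const (measurableSet_spanningSets ν n)]
    exact ENNReal.mul_ne_top (ENNReal.rpow_ne_top_of_nonneg hq0.le (by simp))
      (measure_spanningSets_lt_top ν n).ne
  have key : ∀ n, (∫⁻ x, Hn n x ^ q ∂ν) ^ (1 / q) ≤ R := by
    intro n
    set I := ∫⁻ x, Hn n x ^ q ∂ν with hI
    by_cases hI0 : I = 0
    · rw [hI0, ENNReal.zero_rpow_of_pos (by positivity)]; exact zero_le
    have hconj : q.HolderConjugate (q / (q - 1)) := Real.HolderConjugate.conjExponent h1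
    have h2 : I ≤ R * I ^ (1 - 1 / q) := by
      calc I ≤ ∫⁻ x, H x * Hn n x ^ (q - 1) ∂ν := by
            apply lintegral_mono
            intro x
            show Hn n x ^ q ≤ H x * Hn n x ^ (q - 1)
            calc Hn n x ^ q = Hn n x ^ (1 + (q - 1)) := by congr 1; ring
              _ = Hn n x * Hn n x ^ (q - 1) := by
                rw [ENNReal.rpow_add_of_nonneg _ _ (by norm_num) (by linarith), ENNReal.rpow_one]
              _ ≤ _ := by gcongr; exact hHnle n x
        _ = ∫⁻ x, ∫⁻ t, F t x * Hn n x ^ (q - 1) ∂μ ∂ν := by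
            apply lintegral_congr; intro x
            rw [lintegral_mul_const]
            exact hF.of_uncurry_right
        _ = ∫⁻ t, ∫⁻ x, F t x * Hn n x ^ (q - 1) ∂ν ∂μ := by
            rw [lintegral_lintegral_swap]
            apply Measurable.aemeasurable
            apply Measurable.mul
            · exact hF.comp measurable_swap
            · exact ((hHnm n).comp measurable_fst).pow_const _
        _ ≤ ∫⁻ t, (∫⁻ x, (F t x) ^ q ∂ν) ^ (1 / q) * I ^ (1 - 1 / q) ∂μ := by
            apply lintegral_mono
            intro t
            have := ENNReal.lintegral_mul_le_Lp_mul_Lq ν hconj (f := F t)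
              (g := fun x => Hn n x ^ (q - 1)) hF.of_uncurry_left.aemeasurable
              ((hHnm n).pow_const _).aemeasurable
            refine this.trans (le_of_eq ?_)
            congr 1
            have e1 : ∀ x, (Hn n x ^ (q - 1)) ^ (q / (q - 1)) = Hn n x ^ q := by
              intro x
              rw [← ENNReal.rpow_mul]
              congr 1
              have : q - 1 ≠ 0 := by linarith
              field_simp
            simp only [e1]
            congr 1
            have : q - 1 ≠ 0 := by linarith
            field_simp
        _ = R * I ^ (1 - 1 / q) := by
            rw [lintegral_mul_const]
            apply Measurable.pow_const
            exact Measurable.lintegral_prod_right' (f := fun z : T × X => F z.1 z.2 ^ q)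
              (hF.pow_const q)
    have h3 : I = I ^ (1 / q) * I ^ (1 - 1 / q) := by
      rw [← ENNReal.rpow_add _ _ hI0 (hfin n)]
      simp
    have h4 : I ^ (1 - 1 / q) ≠ 0 := by
      simp only [ne_eq, ENNReal.rpow_eq_zero_iff, hI0, hI ▸ hfin n, false_and, or_self,
        not_false_eq_true]
    have h5 : I ^ (1 - 1 / q) ≠ ∞ := by
      apply ENNReal.rpow_ne_top_of_nonneg _ (hfin n)
      have : 1 / q ≤ 1 := by rw [div_le_one hq0]; exact hq
      linarith
    nth_rewrite 1 [h3] at h2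
    exact (ENNReal.mul_le_mul_iff_left h4 h5).1 h2
  have hmono : ∀ x, Monotone (fun n => Hn n x) := by
    intro x a b hab
    simp only [Hn, indicator]
    by_cases ha : x ∈ S a
    · have hb : x ∈ S b := monotone_spanningSets ν hab ha
      simp only [ha, hb, if_true]
      exact min_le_min le_rfl (by exact_mod_cast hab)
    · simp [ha]
  have hsup : ∀ x, ⨆ n, Hn n x = H x := by
    intro x
    apply le_antisymm (iSup_le fun n => hHnle n x)
    apply le_of_forall_lt
    intro c hc
    obtain ⟨n1, hn1⟩ : ∃ n, x ∈ S n := by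
      have : x ∈ ⋃ n, S n := by rw [iUnion_spanningSets]; trivial
      simpa using this
    obtain ⟨n2, hn2⟩ := ENNReal.exists_nat_gt (ne_top_of_lt hc)
    refine lt_of_lt_of_le ?_ (le_iSup _ (max n1 n2))
    have : x ∈ S (max n1 n2) := monotone_spanningSets ν (le_max_left _ _) hn1
    simp only [Hn, indicator, this, if_true]
    apply lt_min hc (hn2.trans_le _)
    exact_mod_cast le_max_right _ _
  have hlim : ∫⁻ x, H x ^ q ∂ν = ⨆ n, ∫⁻ x, Hn n x ^ q ∂ν := by
    rw [← lintegral_iSup (fun n => (hHnm n).pow_const q)]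
    · apply lintegral_congr
      intro x
      rw [← hsup x]
      exact (ENNReal.orderIsoRpow q hq0).map_iSup _
    · intro a b hab x
      exact ENNReal.rpow_le_rpow (hmono x hab) hq0.le
  rw [one_div, ENNReal.rpow_inv_le_iff hq0]
  show ∫⁻ x, H x ^ q ∂ν ≤ R ^ q
  rw [hlim]
  apply iSup_le
  intro n
  rw [← ENNReal.rpow_inv_le_iff hq0, ← one_div]
  exact key n


section rearrLemmas
variable {X : Type*} [MeasurableSpace X] {μ : Measure X}

theorem rearr_le_iff (f : X → ℝ≥0∞) (t : ℝ) (s : ℝ≥0∞) :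
    rearr μ f t ≤ s ↔ μ {x | s < f x} ≤ ENNReal.ofReal t := by
  constructor
  · intro h
    refine le_trans (measure_mono (fun x (hx : s < f x) => lt_of_le_of_lt h hx)) ?_
    show μ {x | rearr μ f t < f x} ≤ _
    set a := rearr μ f t with ha
    by_cases hatop : a = ∞
    · simp [hatop]
    obtain ⟨u, hu, hul, hut⟩ := exists_seq_strictAnti_tendsto' (lt_top_iff_ne_top.2 hatop)
    have h1 : {x | a < f x} = ⋃ n, {x | u n < f x} := by
      ext x
      simp only [mem_ofPred_eq, mem_iUnion]
      constructor
      · intro hx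
        exact ((hut.eventually_lt_const hx)).exists
      · rintro ⟨n, hn⟩
        exact (hul n).1.trans hn
    rw [h1, Monotone.measure_iUnion]
    · apply iSup_le
      intro n
      obtain ⟨s', hs', hs'u⟩ := sInf_lt_iff.1 (show sInf {s : ℝ≥0∞ | μ {x | s < f x} ≤ ENNReal.ofReal t} < u n from (hul n).1)
      exact (measure_mono (fun x (hx : u n < f x) => hs'u.trans hx)).trans hs'
    · intro a b hab x hx
      exact lt_of_le_of_lt (hu.antitone hab) hx
  · intro h
    exact sInf_le h

theorem lt_rearr_iff (f : X → ℝ≥0∞) (t : ℝ) (s : ℝ≥0∞) :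
    s < rearr μ f t ↔ ENNReal.ofReal t < μ {x | s < f x} := by
  rw [← not_le, rearr_le_iff, not_le]

theorem rearr_antitone (f : X → ℝ≥0∞) : Antitone (rearr μ f) := by
  intro a b hab
  rw [rearr_le_iff]
  exact ((rearr_le_iff f a _).1 le_rfl).trans (ENNReal.ofReal_le_ofReal hab)

theorem rearr_mono_ae {f g : X → ℝ≥0∞} (h : ∀ᵐ x ∂μ, f x ≤ g x) (t : ℝ) :
    rearr μ f t ≤ rearr μ g t := by
  rw [rearr_le_iff]
  refine le_trans (measure_mono_ae ?_) ((rearr_le_iff g t _).1 le_rfl)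
  filter_upwards [h] with x hx
  intro (h1 : _ < f x)
  exact lt_of_lt_of_le h1 hx

theorem rearr_const_mul (f : X → ℝ≥0∞) (c : ℝ≥0∞) (hc : c ≠ 0) (hc' : c ≠ ∞) (t : ℝ) :
    rearr μ (fun x => c * f x) t ≤ c * rearr μ f t := by
  rw [rearr_le_iff]
  refine le_trans (measure_mono ?_) ((rearr_le_iff f t _).1 le_rfl)
  intro x (hx : c * rearr μ f t < c * f x)
  exact (ENNReal.mul_lt_mul_iff_right hc hc').1 hx

theorem measurable_rearr {T : Type*} [MeasurableSpace T] [SFinite μ] (F : T → X → ℝ≥0∞)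
    (hF : Measurable (Function.uncurry F)) :
    Measurable (fun z : T × ℝ => rearr μ (F z.1) z.2) := by
  apply measurable_of_Iic
  intro s
  have : (fun z : T × ℝ => rearr μ (F z.1) z.2) ⁻¹' Iic s =
      {z : T × ℝ | μ {x | s < F z.1 x} ≤ ENNReal.ofReal z.2} := by
    ext z
    simp [rearr_le_iff]
  rw [this]
  apply measurableSet_le
  · have h1 : MeasurableSet {z : T × X | s < F z.1 z.2} := measurableSet_lt measurable_const hF
    exact (measurable_measure_prodMk_left h1).comp measurable_fst
  · exact measurable_snd.ennreal_ofReal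

theorem volume_Ioi_lt (a : ℝ≥0∞) :
    volume.restrict (Ioi (0:ℝ)) {s : ℝ | ENNReal.ofReal s < a} = a := by
  rw [Measure.restrict_apply (measurableSet_lt ENNReal.measurable_ofReal measurable_const)]
  by_cases ha : a = ∞
  · subst ha
    simp
  · have : {s : ℝ | ENNReal.ofReal s < a} ∩ Ioi 0 = Ioo 0 a.toReal := by
      ext s
      simp only [mem_inter_iff, mem_ofPred_eq, mem_Ioi, mem_Ioo]
      constructor
      · rintro ⟨h1, h2⟩
        exact ⟨h2, (ENNReal.ofReal_lt_iff_lt_toReal h2.le ha).1 h1⟩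
      · rintro ⟨h1, h2⟩
        exact ⟨(ENNReal.ofReal_lt_iff_lt_toReal h1.le ha).2 h2, h1⟩
    rw [this, Real.volume_Ioo]
    simp [ha]

theorem layercake_enn [SFinite μ] (g : X → ℝ≥0∞) (hg : Measurable g) :
    ∫⁻ x, g x ∂μ = ∫⁻ s in Ioi (0:ℝ), μ {x | ENNReal.ofReal s < g x} := by
  have hm : MeasurableSet {z : X × ℝ | ENNReal.ofReal z.2 < g z.1} :=
    measurableSet_lt measurable_snd.ennreal_ofReal (hg.comp measurable_fst)
  calc ∫⁻ x, g x ∂μ = ∫⁻ x, ∫⁻ s in Ioi (0:ℝ), {z : X × ℝ | ENNReal.ofReal z.2 < g z.1}.indicator 1 (x, s) ∂volume ∂μ := by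
        apply lintegral_congr
        intro x
        have h1 : ∀ s : ℝ, {z : X × ℝ | ENNReal.ofReal z.2 < g z.1}.indicator (1 : X × ℝ → ℝ≥0∞) (x, s)
          = {s : ℝ | ENNReal.ofReal s < g x}.indicator 1 s := fun s => rfl
        simp only [h1]
        rw [lintegral_indicator_one (measurableSet_lt ENNReal.measurable_ofReal measurable_const),
          volume_Ioi_lt]
    _ = ∫⁻ s in Ioi (0:ℝ), ∫⁻ x, {z : X × ℝ | ENNReal.ofReal z.2 < g z.1}.indicator 1 (x, s) ∂μ := by
        rw [lintegral_lintegral_swap]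
        exact (measurable_one.indicator hm).aemeasurable
    _ = _ := by
        apply lintegral_congr
        intro s
        have h1 : ∀ x : X, {z : X × ℝ | ENNReal.ofReal z.2 < g z.1}.indicator (1 : X × ℝ → ℝ≥0∞) (x, s)
          = {x | ENNReal.ofReal s < g x}.indicator 1 x := fun s => rfl
        simp only [h1]
        rw [lintegral_indicator_one (measurableSet_lt measurable_const hg)]

theorem lintegral_rearr_sub [SFinite μ] (f : X → ℝ≥0∞) (hf : Measurable f) (l : ℝ≥0∞) :
    ∫⁻ s in Ioi (0:ℝ), (rearr μ f s - l) = ∫⁻ x, (f x - l) ∂μ := by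
  have hrm : Measurable (rearr μ f) := (rearr_antitone f).measurable
  rw [layercake_enn (μ := μ) (fun x => f x - l) (hf.sub measurable_const),
    layercake_enn (μ := volume.restrict (Ioi (0:ℝ))) (fun s => rearr μ f s - l) (hrm.sub measurable_const)]
  apply lintegral_congr
  intro u
  simp only [lt_tsub_iff_right]
  simp only [lt_rearr_iff]
  rw [volume_Ioi_lt]

/-- integrated rearrangement -/
def rearrInt (μ : Measure X) (f : X → ℝ≥0∞) (t : ℝ) : ℝ≥0∞ := ∫⁻ s in Ioc 0 t, rearr μ f s

theorem rearrInt_le [SFinite μ] (f : X → ℝ≥0∞) (hf : Measurable f) (t : ℝ) (l : ℝ≥0∞) :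
    rearrInt μ f t ≤ ENNReal.ofReal t * l + ∫⁻ x, (f x - l) ∂μ := by
  rw [← lintegral_rearr_sub f hf l]
  calc rearrInt μ f t ≤ ∫⁻ s in Ioc 0 t, (l + (rearr μ f s - l)) :=
        lintegral_mono fun s => le_add_tsub
    _ = ENNReal.ofReal t * l + ∫⁻ s in Ioc 0 t, (rearr μ f s - l) := by
        rw [lintegral_add_left measurable_const]
        simp [mul_comm]
    _ ≤ _ := by
        gcongr
        exact Ioc_subset_Ioi_self

theorem le_rearrInt [SFinite μ] (f : X → ℝ≥0∞) (hf : Measurable f) (t : ℝ) (ht : 0 < t) :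
    ENNReal.ofReal t * rearr μ f t + ∫⁻ x, (f x - rearr μ f t) ∂μ ≤ rearrInt μ f t := by
  rw [← lintegral_rearr_sub f hf]
  have h1 : ∫⁻ s in Ioi (0:ℝ), (rearr μ f s - rearr μ f t) = ∫⁻ s in Ioc 0 t, (rearr μ f s - rearr μ f t) := by
    rw [← Ioc_union_Ioi_eq_Ioi ht.le, lintegral_union measurableSet_Ioi (Ioc_disjoint_Ioi le_rfl)]
    have : ∫⁻ s in Ioi t, (rearr μ f s - rearr μ f t) = 0 := by
      rw [setLIntegral_congr_fun (g := fun _ => 0) measurableSet_Ioi]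
      · simp
      · intro s hs
        exact tsub_eq_zero_of_le (rearr_antitone f (le_of_lt hs))
    rw [this, add_zero]
  rw [h1]
  have h2 : ENNReal.ofReal t * rearr μ f t = ∫⁻ s in Ioc 0 t, rearr μ f t := by
    simp [mul_comm]
  rw [h2, ← lintegral_add_left measurable_const]
  apply le_of_eq
  apply setLIntegral_congr_fun measurableSet_Ioc
  intro s hs
  exact add_tsub_cancel_of_le (rearr_antitone f hs.2)

theorem rearrInt_mink {T : Type*} [MeasurableSpace T] [SFinite μ] (m : Measure T) [SFinite m]
    (F : T → X → ℝ≥0∞) (hF : Measurable (Function.uncurry F)) (t : ℝ) (ht : 0 < t) :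
    rearrInt μ (fun x => ∫⁻ a, F a x ∂m) t ≤ ∫⁻ a, rearrInt μ (F a) t ∂m := by
  have hl : Measurable fun a => rearr μ (F a) t :=
    (measurable_rearr F hF).comp (measurable_id.prodMk measurable_const)
  have hsub : Measurable fun z : T × X => F z.1 z.2 - rearr μ (F z.1) t :=
    hF.sub (hl.comp measurable_fst)
  calc rearrInt μ (fun x => ∫⁻ a, F a x ∂m) t
      ≤ ENNReal.ofReal t * (∫⁻ a, rearr μ (F a) t ∂m)
        + ∫⁻ x, ((∫⁻ a, F a x ∂m) - ∫⁻ a, rearr μ (F a) t ∂m) ∂μ :=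
        rearrInt_le _ (Measurable.lintegral_prod_left hF) _ _
    _ ≤ ENNReal.ofReal t * (∫⁻ a, rearr μ (F a) t ∂m)
        + ∫⁻ x, ∫⁻ a, (F a x - rearr μ (F a) t) ∂m ∂μ := by
        gcongr with x
        rw [tsub_le_iff_right, ← lintegral_add_right _ hl]
        apply lintegral_mono
        intro a
        exact le_tsub_add
    _ = ∫⁻ a, (ENNReal.ofReal t * rearr μ (F a) t + ∫⁻ x, (F a x - rearr μ (F a) t) ∂μ) ∂m := by
        rw [lintegral_add_left (hl.const_mul _), lintegral_const_mul _ hl, lintegral_lintegral_swap]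
        exact (hsub.comp measurable_swap).aemeasurable
    _ ≤ _ := lintegral_mono fun a => le_rearrInt _ hF.of_uncurry_left _ ht

end rearrLemmas


/-- The weighted norm `‖t^c φ(t)‖_{L^q(dt/t)}`. -/
def Lnorm (c : ℝ) (q : ℝ≥0∞) (φ : ℝ → ℝ≥0∞) : ℝ≥0∞ :=
  if q = ∞ then ⨆ t ∈ Set.Ioi (0 : ℝ), ENNReal.ofReal t ^ c * φ t
  else (∫⁻ t in Set.Ioi (0 : ℝ),
      (ENNReal.ofReal t ^ c * φ t) ^ q.toReal / ENNReal.ofReal t) ^ q⁻¹.toReal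

theorem lorentzNorm_eq {X : Type*} [MeasurableSpace X] (μ : Measure X) (p q : ℝ≥0∞)
    (f : X → ℝ≥0∞) : lorentzNorm μ p q f = Lnorm p⁻¹.toReal q (rearr μ f) := rfl

theorem Lnorm_mono (c : ℝ) (q : ℝ≥0∞) {φ ψ : ℝ → ℝ≥0∞} (h : ∀ t, 0 < t → φ t ≤ ψ t) :
    Lnorm c q φ ≤ Lnorm c q ψ := by
  unfold Lnorm
  split_ifs with hq
  · exact iSup₂_mono fun t ht => mul_le_mul_right (h t ht) _
  · apply ENNReal.rpow_le_rpow _ (by positivity)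
    apply setLIntegral_mono' measurableSet_Ioi
    intro t ht
    have := h t ht
    gcongr

theorem Lnorm_const_mul (c : ℝ) (q : ℝ≥0∞) (hq0 : 0 < q) (φ : ℝ → ℝ≥0∞) (a : ℝ≥0∞) (ha : a ≠ ∞) :
    Lnorm c q (fun t => a * φ t) = a * Lnorm c q φ := by
  unfold Lnorm
  split_ifs with hq
  · simp only [ENNReal.mul_iSup]
    exact iSup_congr fun t => iSup_congr fun _ => mul_left_comm _ _ _
  · have hqp : 0 < q.toReal := ENNReal.toReal_pos hq0.ne' hq
    have h1 : ∀ t : ℝ, (ENNReal.ofReal t ^ c * (a * φ t)) ^ q.toReal / ENNReal.ofReal t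
      = a ^ q.toReal * ((ENNReal.ofReal t ^ c * φ t) ^ q.toReal / ENNReal.ofReal t) := by
      intro t
      rw [← mul_assoc, mul_comm _ a, mul_assoc, ENNReal.mul_rpow_of_nonneg _ _ hqp.le, mul_div_assoc]
    simp only [h1]
    rw [lintegral_const_mul' _ _ (ENNReal.rpow_ne_top_of_nonneg hqp.le ha),
      ENNReal.mul_rpow_of_nonneg _ _ (by positivity), ← ENNReal.rpow_mul, ENNReal.toReal_inv,
      mul_inv_cancel₀ hqp.ne', ENNReal.rpow_one]

/-- The measure `dt/t` on `(0,∞)`. -/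
def mulHaar : Measure ℝ := (volume.restrict (Ioi (0:ℝ))).withDensity (fun t => (ENNReal.ofReal t)⁻¹)

instance : SigmaFinite mulHaar := by
  unfold mulHaar
  apply SigmaFinite.withDensity_of_ne_top
  rw [ae_restrict_iff' measurableSet_Ioi]
  filter_upwards with t ht
  simpa using ht

theorem Lnorm_eq (c : ℝ) (q : ℝ≥0∞) (hq : q ≠ ∞) (φ : ℝ → ℝ≥0∞) (hφ : Measurable φ) :
    Lnorm c q φ = (∫⁻ t, (ENNReal.ofReal t ^ c * φ t) ^ q.toReal ∂mulHaar) ^ (1 / q.toReal) := by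
  unfold Lnorm mulHaar
  rw [if_neg hq, lintegral_withDensity_eq_lintegral_mul _ (by fun_prop) (by fun_prop)]
  congr 1
  · apply lintegral_congr
    intro t
    simp [div_eq_mul_inv, mul_comm]
  · simp

theorem Lnorm_mink {T : Type*} [MeasurableSpace T] (m : Measure T) [SFinite m] (c : ℝ) (q : ℝ≥0∞)
    (hq1 : 1 ≤ q) (F : T → ℝ → ℝ≥0∞) (hF : Measurable (Function.uncurry F)) :
    Lnorm c q (fun t => ∫⁻ a, F a t ∂m) ≤ ∫⁻ a, Lnorm c q (F a) ∂m := by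
  by_cases hq : q = ∞
  · unfold Lnorm
    simp only [hq, if_true]
    refine iSup₂_le fun t ht => ?_
    rw [← lintegral_const_mul _ hF.of_uncurry_right]
    apply lintegral_mono
    intro a
    exact le_iSup₂_of_le t ht le_rfl
  · have hq' : 1 ≤ q.toReal := by
      rw [← ENNReal.toReal_one]
      exact ENNReal.toReal_mono hq hq1
    rw [Lnorm_eq c q hq _ (Measurable.lintegral_prod_left hF)]
    simp only [fun a => Lnorm_eq c q hq (F a) hF.of_uncurry_left]
    have := mink_lintegral m mulHaar q.toReal hq' (fun a t => ENNReal.ofReal t ^ c * F a t) (by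
      apply Measurable.mul _ hF
      fun_prop)
    refine le_trans (le_of_eq ?_) this
    congr 1
    apply lintegral_congr
    intro t
    rw [lintegral_const_mul _ hF.of_uncurry_right]

theorem lintegral_comp_mul_left' (s : ℝ) (hs : s ≠ 0) (g : ℝ → ℝ≥0∞) :
    ∫⁻ t, g (s * t) = ENNReal.ofReal |s⁻¹| * ∫⁻ t, g t := by
  have := lintegral_map_equiv (μ := volume) g (Homeomorph.mulLeft₀ s hs).toMeasurableEquiv
  simp only [Homeomorph.toMeasurableEquiv_coe, Homeomorph.coe_mulLeft₀] at this
  rw [← this, Real.map_volume_mul_left hs, lintegral_smul_measure, smul_eq_mul]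

theorem Lnorm_dil (c : ℝ) (q : ℝ≥0∞) (hq0 : 0 < q) (φ : ℝ → ℝ≥0∞) (s : ℝ) (hs : 0 < s) :
    Lnorm c q (fun t => φ (s * t)) ≤ ENNReal.ofReal s ^ (-c) * Lnorm c q φ := by
  have hs0 : ENNReal.ofReal s ≠ 0 := by simpa using hs
  have hst : ENNReal.ofReal s ≠ ∞ := ENNReal.ofReal_ne_top
  have hsc : ∀ t, ENNReal.ofReal t ^ c * φ (s * t) =
      ENNReal.ofReal s ^ (-c) * (ENNReal.ofReal (s * t) ^ c * φ (s * t)) := by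
    intro t
    rw [← mul_assoc]
    congr 1
    rw [ENNReal.ofReal_mul hs.le, ENNReal.mul_rpow_of_ne_top hst ENNReal.ofReal_ne_top, ← mul_assoc,
      ← ENNReal.rpow_add _ _ hs0 hst]
    simp
  have hne : ENNReal.ofReal s ^ (-c) ≠ ∞ := by
    simp [ENNReal.rpow_eq_top_iff, hs]
  unfold Lnorm
  split_ifs with hq
  · refine iSup₂_le fun t ht => ?_
    rw [hsc]
    gcongr
    exact le_iSup₂_of_le (f := fun (t:ℝ) (_ : t ∈ Ioi 0) => ENNReal.ofReal t ^ c * φ t) (s * t)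
      (mul_pos hs ht) le_rfl
  · have hqp : 0 < q.toReal := ENNReal.toReal_pos hq0.ne' hq
    have h1 : ∫⁻ t in Set.Ioi (0 : ℝ),
      (ENNReal.ofReal t ^ c * φ (s * t)) ^ q.toReal / ENNReal.ofReal t
      = (ENNReal.ofReal s ^ (-c)) ^ q.toReal * ∫⁻ t in Set.Ioi (0 : ℝ),
      (ENNReal.ofReal t ^ c * φ t) ^ q.toReal / ENNReal.ofReal t := by
      rw [← lintegral_indicator measurableSet_Ioi, ← lintegral_indicator measurableSet_Ioi]
      have h2 := lintegral_comp_mul_left' s hs.ne' ((Ioi 0).indicator fun t =>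
        (ENNReal.ofReal t ^ c * φ t) ^ q.toReal / ENNReal.ofReal t)
      have h3 : ∫⁻ t, (Ioi 0).indicator (fun t =>
        (ENNReal.ofReal t ^ c * φ t) ^ q.toReal / ENNReal.ofReal t) t
        = ENNReal.ofReal s * ∫⁻ t, (Ioi 0).indicator (fun t =>
        (ENNReal.ofReal t ^ c * φ t) ^ q.toReal / ENNReal.ofReal t) (s * t) := by
        rw [h2, ← mul_assoc, ← ENNReal.ofReal_mul hs.le, abs_of_pos (inv_pos.2 hs),
          mul_inv_cancel₀ hs.ne']
        simp
      rw [h3, ← lintegral_const_mul' _ _ hst, ← lintegral_const_mul' _ _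
        (ENNReal.rpow_ne_top_of_nonneg hqp.le hne)]
      apply lintegral_congr
      intro t
      by_cases ht : 0 < t
      · have hst' : 0 < s * t := mul_pos hs ht
        simp only [indicator, mem_Ioi, ht, hst', if_true]
        rw [hsc, ENNReal.mul_rpow_of_nonneg _ _ hqp.le, mul_div_assoc]
        congr 1
        rw [ENNReal.ofReal_mul hs.le, div_eq_mul_inv, div_eq_mul_inv,
          ENNReal.mul_inv (Or.inl hs0) (Or.inl hst)]
        rw [mul_left_comm (ENNReal.ofReal s), ← mul_assoc (ENNReal.ofReal s),
          ENNReal.mul_inv_cancel hs0 hst, one_mul]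
      · have hst' : ¬ 0 < s * t := by
          intro h
          exact ht (pos_of_mul_pos_right h hs.le)
        simp only [indicator, mem_Ioi, ht, hst', if_false]
        simp
    rw [h1, ENNReal.mul_rpow_of_nonneg _ _ (by positivity), ← ENNReal.rpow_mul, ENNReal.toReal_inv,
      mul_inv_cancel₀ hqp.ne', ENNReal.rpow_one]

section
variable {X : Type*} [MeasurableSpace X] {μ : Measure X}

/-- The maximal average of the rearrangement. -/
def rearrAvg (μ : Measure X) (f : X → ℝ≥0∞) (t : ℝ) : ℝ≥0∞ := ∫⁻ s in Ioc (0:ℝ) 1, rearr μ f (s * t)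

theorem rearrAvg_eq (f : X → ℝ≥0∞) (t : ℝ) (ht : 0 < t) :
    rearrAvg μ f t = ENNReal.ofReal t⁻¹ * rearrInt μ f t := by
  unfold rearrAvg rearrInt
  rw [← lintegral_indicator measurableSet_Ioc, ← lintegral_indicator measurableSet_Ioc]
  have h2 := lintegral_comp_mul_left' t ht.ne' ((Ioc 0 t).indicator fun s => rearr μ f s)
  rw [abs_of_pos (inv_pos.2 ht)] at h2
  rw [← h2]
  apply lintegral_congr
  intro s
  have : s ∈ Ioc (0:ℝ) 1 ↔ t * s ∈ Ioc 0 t := by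
    simp only [mem_Ioc]
    rw [mul_pos_iff_of_pos_left ht, mul_le_iff_le_one_right ht]
  simp only [indicator, this, mul_comm s t]

theorem rearr_le_avg (f : X → ℝ≥0∞) (t : ℝ) (ht : 0 < t) : rearr μ f t ≤ rearrAvg μ f t := by
  unfold rearrAvg
  calc rearr μ f t = ∫⁻ s in Ioc (0:ℝ) 1, rearr μ f t := by simp
    _ ≤ _ := by
      apply setLIntegral_mono' measurableSet_Ioc
      intro s hs
      apply rearr_antitone
      nlinarith [hs.1, hs.2]

theorem rearrAvg_mink {T : Type*} [MeasurableSpace T] [SFinite μ] (m : Measure T) [SFinite m]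
    (F : T → X → ℝ≥0∞) (hF : Measurable (Function.uncurry F)) (t : ℝ) (ht : 0 < t) :
    rearrAvg μ (fun x => ∫⁻ a, F a x ∂m) t ≤ ∫⁻ a, rearrAvg μ (F a) t ∂m := by
  simp only [rearrAvg_eq _ t ht]
  rw [lintegral_const_mul' _ _ ENNReal.ofReal_ne_top]
  gcongr
  exact rearrInt_mink m F hF t ht

/-- Normability of Lorentz spaces, constant. -/
def lorC (c : ℝ) : ℝ≥0∞ := ∫⁻ s in Ioc (0:ℝ) 1, ENNReal.ofReal s ^ (-c)

theorem lorC_ne_top (c : ℝ) (hc : c < 1) : lorC c ≠ ∞ := by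
  unfold lorC
  have h1 : IntegrableOn (fun s : ℝ => s ^ (-c)) (Ioc 0 1) := by
    have := intervalIntegral.intervalIntegrable_rpow' (a := 0) (b := 1) (r := -c) (by linarith)
    rwa [intervalIntegrable_iff_integrableOn_Ioc_of_le zero_le_one] at this
  have h2 := h1.2
  rw [hasFiniteIntegral_iff_enorm] at h2
  refine ne_of_lt (lt_of_le_of_lt (le_of_eq ?_) h2)
  apply setLIntegral_congr_fun measurableSet_Ioc
  intro s hs
  simp only
  rw [Real.enorm_eq_ofReal (Real.rpow_nonneg hs.1.le _), ENNReal.ofReal_rpow_of_pos hs.1]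

theorem Lnorm_avg (c : ℝ) (q : ℝ≥0∞) (hq : 1 ≤ q) (f : X → ℝ≥0∞) :
    Lnorm c q (rearrAvg μ f) ≤ lorC c * Lnorm c q (rearr μ f) := by
  have hm : Measurable (Function.uncurry fun (s t : ℝ) => rearr μ f (s * t)) :=
    (rearr_antitone f).measurable.comp (measurable_fst.mul measurable_snd)
  calc Lnorm c q (rearrAvg μ f)
      ≤ ∫⁻ s in Ioc (0:ℝ) 1, Lnorm c q (fun t => rearr μ f (s * t)) :=
        Lnorm_mink (volume.restrict (Ioc (0:ℝ) 1)) c q hq (fun s t => rearr μ f (s * t)) hm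
    _ ≤ ∫⁻ s in Ioc (0:ℝ) 1, ENNReal.ofReal s ^ (-c) * Lnorm c q (rearr μ f) := by
        apply setLIntegral_mono' measurableSet_Ioc
        intro s hs
        exact Lnorm_dil c q (lt_of_lt_of_le one_pos hq) _ s hs.1
    _ = _ := by
        rw [lintegral_mul_const _ (by fun_prop)]
        rfl

theorem lorentz_mink {T : Type*} [MeasurableSpace T] [SFinite μ] (m : Measure T) [SFinite m]
    (p q : ℝ≥0∞) (hq : 1 ≤ q) (hC : lorC p⁻¹.toReal ≠ ∞)
    (F : T → X → ℝ≥0∞) (hF : Measurable (Function.uncurry F)) :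
    lorentzNorm μ p q (fun x => ∫⁻ a, F a x ∂m) ≤
      lorC p⁻¹.toReal * ∫⁻ a, lorentzNorm μ p q (F a) ∂m := by
  simp only [lorentzNorm_eq]
  have hm : Measurable (Function.uncurry fun a t => rearrAvg μ (F a) t) := by
    unfold rearrAvg
    apply Measurable.lintegral_prod_right' (f := fun z : (T × ℝ) × ℝ => rearr μ (F z.1.1) (z.2 * z.1.2))
    exact (measurable_rearr F hF).comp ((measurable_fst.comp measurable_fst).prodMk
      (measurable_snd.mul (measurable_snd.comp measurable_fst)))
  calc Lnorm p⁻¹.toReal q (rearr μ fun x => ∫⁻ a, F a x ∂m)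
      ≤ Lnorm p⁻¹.toReal q (rearrAvg μ fun x => ∫⁻ a, F a x ∂m) :=
        Lnorm_mono _ _ fun t ht => rearr_le_avg _ t ht
    _ ≤ Lnorm p⁻¹.toReal q (fun t => ∫⁻ a, rearrAvg μ (F a) t ∂m) :=
        Lnorm_mono _ _ fun t ht => rearrAvg_mink m F hF t ht
    _ ≤ ∫⁻ a, Lnorm p⁻¹.toReal q (rearrAvg μ (F a)) ∂m := Lnorm_mink m _ q hq _ hm
    _ ≤ ∫⁻ a, lorC p⁻¹.toReal * Lnorm p⁻¹.toReal q (rearr μ (F a)) ∂m :=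
        lintegral_mono fun a => Lnorm_avg _ q hq (F a)
    _ = _ := lintegral_const_mul' _ _ hC

theorem measurable_lorentz {T : Type*} [MeasurableSpace T] [SFinite μ]
    (p q : ℝ≥0∞) (F : T → X → ℝ≥0∞) (hF : Measurable (Function.uncurry F)) :
    Measurable fun a => lorentzNorm μ p q (F a) := by
  have hr := measurable_rearr (μ := μ) F hF
  simp only [lorentzNorm_eq]
  unfold Lnorm
  split_ifs with hq
  · have h1 : ∀ a, ⨆ t ∈ Ioi (0:ℝ), ENNReal.ofReal t ^ p⁻¹.toReal * rearr μ (F a) t =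
        ⨆ r : ℚ, ⨆ _ : 0 < r, ENNReal.ofReal (r:ℝ) ^ p⁻¹.toReal * rearr μ (F a) r := by
      intro a
      apply le_antisymm
      · refine iSup₂_le fun t ht => ?_
        obtain ⟨u, hu, hlt, hut⟩ := Real.exists_seq_rat_strictMono_tendsto t
        have hlim : Filter.Tendsto (fun n => ENNReal.ofReal (u n : ℝ) ^ p⁻¹.toReal * rearr μ (F a) t)
            Filter.atTop (nhds (ENNReal.ofReal t ^ p⁻¹.toReal * rearr μ (F a) t)) := by
          apply ENNReal.Tendsto.mul_const
          · exact ((ENNReal.continuous_rpow_const.comp ENNReal.continuous_ofReal).tendsto t).comp hut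
          · left
            have : 0 < t := ht
            simp [ENNReal.rpow_eq_zero_iff, this]
        refine le_of_tendsto hlim ?_
        filter_upwards [hut.eventually_const_lt (show 0 < t from ht)] with n hn
        have hn' : 0 < u n := by exact_mod_cast hn
        refine le_trans ?_ (le_iSup₂_of_le (u n) hn' le_rfl)
        gcongr
        exact rearr_antitone _ (hlt n).le
      · refine iSup₂_le fun r hr => ?_
        have : (r:ℝ) ∈ Ioi (0:ℝ) := by simpa using hr
        exact le_iSup₂_of_le (f := fun (t:ℝ) (_ : t ∈ Ioi 0) => ENNReal.ofReal t ^ p⁻¹.toReal * rearr μ (F a) t) (r:ℝ) this le_rfl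
    simp only [h1]
    refine Measurable.iSup fun r => Measurable.iSup fun _ => ?_
    exact measurable_const.mul (hr.comp (measurable_id.prodMk measurable_const))
  · apply Measurable.pow_const
    apply Measurable.lintegral_prod_right' (f := fun z : T × ℝ =>
      (ENNReal.ofReal z.2 ^ p⁻¹.toReal * rearr μ (F z.1) z.2) ^ q.toReal / ENNReal.ofReal z.2)
    fun_prop

theorem lorentz_mono_ae (p q : ℝ≥0∞) {f g : X → ℝ≥0∞} (h : ∀ᵐ x ∂μ, f x ≤ g x) :
    lorentzNorm μ p q f ≤ lorentzNorm μ p q g :=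
  Lnorm_mono _ _ fun t _ => rearr_mono_ae h t

theorem lorentz_const_mul (p q : ℝ≥0∞) (hq : 0 < q) (f : X → ℝ≥0∞) (a : ℝ≥0∞) (ha0 : a ≠ 0) (ha : a ≠ ∞) :
    lorentzNorm μ p q (fun x => a * f x) ≤ a * lorentzNorm μ p q f := by
  simp only [lorentzNorm_eq]
  rw [← Lnorm_const_mul _ q hq _ a ha]
  exact Lnorm_mono _ _ fun t _ => rearr_const_mul f a ha0 ha t

end

theorem lorentz_dil (p q : ℝ≥0∞) (hq : 0 < q) (f : ℝ → ℝ≥0∞) (a : ℝ) (ha : a ≠ 0) :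
    lorentzNorm (volume : Measure ℝ) p q (fun x => f (a * x)) ≤
      ENNReal.ofReal |a| ^ (-p⁻¹.toReal) * lorentzNorm volume p q f := by
  have ha' : 0 < |a| := abs_pos.2 ha
  simp only [lorentzNorm_eq]
  refine le_trans (Lnorm_mono _ _ fun t ht => ?_) (Lnorm_dil _ q hq _ |a| ha')
  rw [rearr_le_iff]
  have h0 := (rearr_le_iff (μ := volume) f (|a| * t) _).1 le_rfl
  have h1 : {x | rearr volume f (|a| * t) < f (a * x)} =
    (fun x => a * x) ⁻¹' {x | rearr volume f (|a| * t) < f x} := rfl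
  rw [h1, Real.volume_preimage_mul_left ha]
  calc _ ≤ ENNReal.ofReal |a⁻¹| * ENNReal.ofReal (|a| * t) := by gcongr
    _ = ENNReal.ofReal t := by
      rw [← ENNReal.ofReal_mul (abs_nonneg _), abs_inv, ← mul_assoc, inv_mul_cancel₀ ha'.ne', one_mul]


/-- Functionals which are monotone (off an exceptional set), homogeneous, preserve measurability
in parameters, and satisfy Minkowski's integral inequality up to a constant. -/
structure NiceN {X : Type} [MeasurableSpace X] (S : Set X) (N : (X → ℝ≥0∞) → ℝ≥0∞) : Prop where
  mono : ∀ f g : X → ℝ≥0∞, (∀ x ∈ S, f x ≤ g x) → N f ≤ N g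
  meas : ∀ (T : Type) [MeasurableSpace T] (F : T → X → ℝ≥0∞), Measurable (Function.uncurry F) →
    Measurable fun t => N (F t)
  mink : ∃ A : ℝ≥0∞, A ≠ ∞ ∧ ∀ (T : Type) [MeasurableSpace T] (m : Measure T) [SFinite m]
    (F : T → X → ℝ≥0∞), Measurable (Function.uncurry F) →
    N (fun x => ∫⁻ t, F t x ∂m) ≤ A * ∫⁻ t, N (F t) ∂m
  hom : ∀ (f : X → ℝ≥0∞) (a : ℝ≥0∞), a ≠ 0 → a ≠ ∞ → N (fun x => a * f x) ≤ a * N f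

theorem NiceN.comp {X Y Z : Type} [MeasurableSpace X] [MeasurableSpace Y] [MeasurableSpace Z]
    {S₁ : Set X} {S₂ : Set Y} {S : Set Z} {N₁ : (X → ℝ≥0∞) → ℝ≥0∞} {N₂ : (Y → ℝ≥0∞) → ℝ≥0∞}
    (h₁ : NiceN S₁ N₁) (h₂ : NiceN S₂ N₂) (c : X → Y → Z) (hc : Measurable (Function.uncurry c))
    (hS : ∀ x ∈ S₁, ∀ y ∈ S₂, c x y ∈ S) :
    NiceN S (fun f => N₂ (fun y => N₁ (fun x => f (c x y)))) := by
  have hmeas : ∀ (T : Type) [MeasurableSpace T] (F : T → Z → ℝ≥0∞), Measurable (Function.uncurry F) →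
      Measurable fun z : T × Y => N₁ (fun x => F z.1 (c x z.2)) := by
    intro T _ F hF
    apply h₁.meas (T × Y) (fun z x => F z.1 (c x z.2))
    exact hF.comp ((measurable_fst.comp measurable_fst).prodMk
      (hc.comp (measurable_snd.prodMk (measurable_snd.comp measurable_fst))))
  constructor
  · intro f g hfg
    exact h₂.mono _ _ fun y hy => h₁.mono _ _ fun x hx => hfg _ (hS x hx y hy)
  · intro T _ F hF
    exact h₂.meas T (fun t y => N₁ (fun x => F t (c x y))) (hmeas T F hF)
  · obtain ⟨A₁, hA₁, hm₁⟩ := h₁.mink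
    obtain ⟨A₂, hA₂, hm₂⟩ := h₂.mink
    refine ⟨A₂ * A₁, ENNReal.mul_ne_top hA₂ hA₁, ?_⟩
    intro T _ m _ F hF
    calc N₂ (fun y => N₁ (fun x => ∫⁻ t, F t (c x y) ∂m))
        ≤ N₂ (fun y => ∫⁻ t, N₁ (fun x => F t (c x y)) ∂(A₁ • m)) := by
          apply h₂.mono
          intro y _
          rw [lintegral_smul_measure]
          apply hm₁ T m (fun t x => F t (c x y))
          exact hF.comp (measurable_fst.prodMk (hc.comp (measurable_snd.prodMk measurable_const)))
      _ ≤ A₂ * ∫⁻ t, N₂ (fun y => N₁ (fun x => F t (c x y))) ∂(A₁ • m) :=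
          hm₂ T (A₁ • m) (fun t y => N₁ (fun x => F t (c x y))) (hmeas T F hF)
      _ = _ := by rw [lintegral_smul_measure, smul_eq_mul, mul_assoc]
  · intro f a ha ha'
    refine le_trans (h₂.mono _ _ fun y _ => h₁.hom _ a ha ha') (h₂.hom _ a ha ha')

theorem NiceN.eval {X : Type} [MeasurableSpace X] (S : Set X) (x₀ : X) (h : x₀ ∈ S) :
    NiceN S (fun f => f x₀) := by
  constructor
  · exact fun f g hfg => hfg x₀ h
  · exact fun T _ F hF => hF.of_uncurry_right
  · exact ⟨1, by simp, fun T _ m _ F hF => by simp⟩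
  · exact fun f a _ _ => le_rfl

theorem ofReal_inv_toReal {P : ℝ} (hP : 1 < P) : (ENNReal.ofReal P)⁻¹.toReal = P⁻¹ := by
  rw [ENNReal.toReal_inv, ENNReal.toReal_ofReal (by linarith)]

theorem nice_lorentz (P : ℝ) (hP : 1 < P) (q : ℝ≥0∞) (hq : 1 ≤ q) :
    NiceN {x : ℝ | x ≠ 0} (lorentzNorm (volume : Measure ℝ) (ENNReal.ofReal P) q) := by
  constructor
  · intro f g h
    apply lorentz_mono_ae
    filter_upwards [compl_mem_ae_iff.2 (measure_singleton (0:ℝ) (μ := volume))] with x hx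
    exact h x hx
  · intro T _ F hF
    exact measurable_lorentz _ _ F hF
  · have hC : lorC (ENNReal.ofReal P)⁻¹.toReal ≠ ∞ := by
      apply lorC_ne_top
      rw [ofReal_inv_toReal hP]
      exact inv_lt_one_of_one_lt₀ hP
    exact ⟨_, hC, fun T _ m _ F hF => lorentz_mink m _ q hq hC F hF⟩
  · intro f a ha ha'
    exact lorentz_const_mul _ q (lt_of_lt_of_le one_pos hq) f a ha ha'

theorem measurable_fin_cons {n : ℕ} {α : Fin (n + 1) → Type} [∀ j, MeasurableSpace (α j)] :
    Measurable (Function.uncurry fun (x : α 0) (y : ∀ j : Fin n, α j.succ) =>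
      (Fin.cons x y : ∀ j, α j)) := by
  rw [measurable_pi_iff]
  intro j
  refine Fin.cases ?_ (fun j => ?_) j
  · exact measurable_fst
  · exact (measurable_pi_apply j).comp measurable_snd

theorem mixedLorentz_succ_eq (n : ℕ) (p q : Fin (n + 1) → ℝ≥0∞) :
    mixedLorentz (n + 1) p q = fun f => mixedLorentz n (fun i => p i.succ) (fun i => q i.succ)
      (fun y => lorentzNorm (volume : Measure ℝ) (p 0) (q 0) (fun x => f (Fin.cons x y))) := rfl

theorem grpNorm_succ_eq (i : ℕ) (k : Fin (i + 1) → ℕ) (P Q : (j : Fin (i + 1)) → Fin (k j) → ℝ≥0∞) :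
    grpNorm (i + 1) k P Q = fun f => grpNorm i (fun j => k j.succ) (fun j => P j.succ)
      (fun j => Q j.succ) (fun ys => mixedLorentz (k 0) (P 0) (Q 0) (fun x => f (Fin.cons x ys))) := rfl

theorem nice_mixed (n : ℕ) : ∀ (P : Fin n → ℝ) (_ : ∀ l, 1 < P l) (Q : Fin n → ℝ≥0∞)
    (_ : ∀ l, 1 ≤ Q l),
    NiceN {x : Fin n → ℝ | ∀ l, x l ≠ 0} (mixedLorentz n (fun l => ENNReal.ofReal (P l)) Q) := by
  induction n with
  | zero => exact fun P _ Q _ => NiceN.eval _ _ fun l => l.elim0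
  | succ n ih =>
    intro P hP Q hQ
    rw [mixedLorentz_succ_eq]
    apply NiceN.comp (nice_lorentz (P 0) (hP 0) (Q 0) (hQ 0))
      (ih (fun l => P l.succ) (fun l => hP _) (fun l => Q l.succ) (fun l => hQ _))
      (fun x y => (Fin.cons x y : Fin (n + 1) → ℝ)) (measurable_fin_cons (α := fun _ => ℝ))
    intro x hx y hy l
    refine Fin.cases ?_ (fun l => ?_) l
    · exact hx
    · exact hy l

theorem nice_grp (i : ℕ) : ∀ (k : Fin i → ℕ) (P : (j : Fin i) → Fin (k j) → ℝ) (_ : ∀ j l, 1 < P j l)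
    (Q : (j : Fin i) → Fin (k j) → ℝ≥0∞) (_ : ∀ j l, 1 ≤ Q j l),
    NiceN {x : ∀ j : Fin i, Fin (k j) → ℝ | ∀ j l, x j l ≠ 0}
      (grpNorm i k (fun j l => ENNReal.ofReal (P j l)) Q) := by
  induction i with
  | zero => exact fun k P _ Q _ => NiceN.eval _ _ fun l => l.elim0
  | succ n ih =>
    intro k P hP Q hQ
    rw [grpNorm_succ_eq]
    apply NiceN.comp (nice_mixed (k 0) (P 0) (hP 0) (Q 0) (hQ 0))
      (ih (fun j => k j.succ) (fun l => P l.succ) (fun l => hP _) (fun l => Q l.succ)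
        (fun l => hQ _))
      (fun x y => (Fin.cons x y : ∀ j : Fin (n + 1), Fin (k j) → ℝ))
      (measurable_fin_cons (α := fun j => Fin (k j) → ℝ))
    intro x hx y hy l
    refine Fin.cases ?_ (fun l => ?_) l
    · exact hx
    · exact hy l

theorem ofReal_abs_rpow_ne {a : ℝ} (ha : a ≠ 0) (c : ℝ) :
    ENNReal.ofReal |a| ^ c ≠ 0 ∧ ENNReal.ofReal |a| ^ c ≠ ∞ := by
  have : 0 < |a| := abs_pos.2 ha
  rw [ENNReal.ofReal_rpow_of_pos this]
  exact ⟨by simpa using Real.rpow_pos_of_pos this c, ENNReal.ofReal_ne_top⟩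

theorem dil_mixed : ∀ (n : ℕ) (P : Fin n → ℝ) (_ : ∀ l, 1 < P l) (Q : Fin n → ℝ≥0∞)
    (_ : ∀ l, 1 ≤ Q l) (t : Fin n → ℝ) (_ : ∀ l, t l ≠ 0) (f : (Fin n → ℝ) → ℝ≥0∞),
    mixedLorentz n (fun l => ENNReal.ofReal (P l)) Q (fun x => f (fun l => t l * x l)) ≤
      (∏ l, ENNReal.ofReal |t l| ^ (-(P l)⁻¹)) * mixedLorentz n (fun l => ENNReal.ofReal (P l)) Q f
  | 0, P, hP, Q, hQ, t, ht, f => by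
    simp only [mixedLorentz, Finset.univ_eq_empty, Finset.prod_empty, one_mul]
    exact le_of_eq (congrArg f (Subsingleton.elim _ _))
  | n + 1, P, hP, Q, hQ, t, ht, f => by
    have hN := nice_mixed n (fun l => P l.succ) (fun l => hP _) (fun l => Q l.succ) (fun l => hQ _)
    simp only [mixedLorentz]
    have e : ∀ (x : ℝ) (y : Fin n → ℝ), (fun l => t l * (Fin.cons x y : Fin (n+1) → ℝ) l) =
        Fin.cons (t 0 * x) (fun l => t l.succ * y l) := by
      intro x y
      ext l
      refine Fin.cases ?_ (fun l => ?_) l <;> simp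
    simp only [e]
    have h0 := ofReal_abs_rpow_ne (ht 0) (-(P 0)⁻¹)
    rw [Fin.prod_univ_succ, mul_assoc]
    refine le_trans (hN.mono _ (fun y => ENNReal.ofReal |t 0| ^ (-(P 0)⁻¹) *
      lorentzNorm volume (ENNReal.ofReal (P 0)) (Q 0)
        (fun x => f (Fin.cons x (fun l => t l.succ * y l)))) fun y _ => ?_) ?_
    · have := lorentz_dil (ENNReal.ofReal (P 0)) (Q 0) (lt_of_lt_of_le one_pos (hQ 0))
        (fun x => f (Fin.cons x (fun l => t l.succ * y l))) (t 0) (ht 0)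
      rwa [ofReal_inv_toReal (hP 0)] at this
    · refine le_trans (hN.hom _ _ h0.1 h0.2) ?_
      gcongr
      exact dil_mixed n (fun l => P l.succ) (fun l => hP _) (fun l => Q l.succ) (fun l => hQ _)
        (fun l => t l.succ) (fun l => ht _)
        (fun y => lorentzNorm volume (ENNReal.ofReal (P 0)) (Q 0) (fun x => f (Fin.cons x y)))

theorem dil_grp : ∀ (i : ℕ) (k : Fin i → ℕ) (P : (j : Fin i) → Fin (k j) → ℝ) (_ : ∀ j l, 1 < P j l)
    (Q : (j : Fin i) → Fin (k j) → ℝ≥0∞) (_ : ∀ j l, 1 ≤ Q j l)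
    (t : (j : Fin i) → Fin (k j) → ℝ) (_ : ∀ j l, t j l ≠ 0)
    (f : ((j : Fin i) → Fin (k j) → ℝ) → ℝ≥0∞),
    grpNorm i k (fun j l => ENNReal.ofReal (P j l)) Q (fun x => f (fun j l => t j l * x j l)) ≤
      (∏ j, ∏ l, ENNReal.ofReal |t j l| ^ (-(P j l)⁻¹)) *
        grpNorm i k (fun j l => ENNReal.ofReal (P j l)) Q f
  | 0, k, P, hP, Q, hQ, t, ht, f => by
    simp only [grpNorm, Finset.univ_eq_empty, Finset.prod_empty, one_mul]
    exact le_of_eq (congrArg f (Subsingleton.elim _ _))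
  | n + 1, k, P, hP, Q, hQ, t, ht, f => by
    have hN := nice_grp n (fun j => k j.succ) (fun l => P l.succ) (fun l => hP _)
      (fun l => Q l.succ) (fun l => hQ _)
    simp only [grpNorm]
    have e : ∀ (x : Fin (k 0) → ℝ) (y : ∀ j : Fin n, Fin (k j.succ) → ℝ),
        (fun j l => t j l * (Fin.cons x y : ∀ j : Fin (n+1), Fin (k j) → ℝ) j l) =
        Fin.cons (α := fun j => Fin (k j) → ℝ) (fun l => t 0 l * x l) (fun j l => t j.succ l * y j l) := by
      intro x y
      funext j
      refine Fin.cases ?_ (fun j => ?_) j <;> rfl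
    simp only [e]
    have h0 : ∏ l, ENNReal.ofReal |t 0 l| ^ (-(P 0 l)⁻¹) ≠ 0 :=
      Finset.prod_ne_zero_iff.2 fun l _ => (ofReal_abs_rpow_ne (ht 0 l) _).1
    have h1 : ∏ l, ENNReal.ofReal |t 0 l| ^ (-(P 0 l)⁻¹) ≠ ∞ :=
      ENNReal.prod_ne_top fun l _ => (ofReal_abs_rpow_ne (ht 0 l) _).2
    rw [Fin.prod_univ_succ, mul_assoc]
    refine le_trans (hN.mono _ (fun y => (∏ l, ENNReal.ofReal |t 0 l| ^ (-(P 0 l)⁻¹)) *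
      mixedLorentz (k 0) (fun l => ENNReal.ofReal (P 0 l)) (Q 0)
        (fun x => f (Fin.cons x (fun j l => t j.succ l * y j l)))) fun y _ => ?_) ?_
    · exact dil_mixed (k 0) (P 0) (hP 0) (Q 0) (hQ 0) (t 0) (ht 0)
        (fun x => f (Fin.cons x (fun j l => t j.succ l * y j l)))
    · refine le_trans (hN.hom _ _ h0 h1) ?_
      gcongr
      exact dil_grp n (fun j => k j.succ) (fun l => P l.succ) (fun l => hP _) (fun l => Q l.succ)
        (fun l => hQ _) (fun l => t l.succ) (fun l => ht _)
        (fun y => mixedLorentz (k 0) (fun l => ENNReal.ofReal (P 0 l)) (Q 0)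
          (fun x => f (Fin.cons x y)))


theorem lintegral_abs_le (g : ℝ → ℝ≥0∞) (hg : Measurable g) :
    ∫⁻ t, g |t| ≤ 2 * ∫⁻ t in Ioi (0:ℝ), g t := by
  have h0 := lintegral_comp_mul_left' (-1) (by norm_num) ((Ioi (0:ℝ)).indicator g)
  have hm : Measurable ((Ioi (0:ℝ)).indicator g) := hg.indicator measurableSet_Ioi
  rw [lintegral_indicator measurableSet_Ioi] at h0
  have h1 : ∫⁻ t, g |t| ≤ ∫⁻ t, ((Ioi (0:ℝ)).indicator g t + (Ioi (0:ℝ)).indicator g (-1 * t)) := by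
    apply lintegral_mono_ae
    filter_upwards [compl_mem_ae_iff.2 (measure_singleton (0:ℝ) (μ := volume))] with t ht
    rcases lt_or_gt_of_ne (show t ≠ 0 from ht) with h | h
    · refine le_trans ?_ le_add_self
      have : (-1 * t) ∈ Ioi (0:ℝ) := by simpa using h
      rw [indicator_of_mem this, abs_of_neg h]
      simp
    · refine le_trans ?_ le_self_add
      rw [indicator_of_mem (show t ∈ Ioi (0:ℝ) from h), abs_of_pos h]
  refine h1.trans ?_
  rw [lintegral_add_left hm, h0, lintegral_indicator measurableSet_Ioi]
  simp [two_mul]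

theorem lint_near (b R : ℝ) (hb : b < 1) (hR : 0 < R) :
    ∫⁻ t : ℝ, (Iic R).indicator (fun u => ENNReal.ofReal u ^ (-b)) |t| < ∞ := by
  refine lt_of_le_of_lt (lintegral_abs_le _ (Measurable.indicator (by fun_prop) measurableSet_Iic)) ?_
  apply ENNReal.mul_lt_top (by simp)
  have h1 : IntegrableOn (fun s : ℝ => s ^ (-b)) (Ioc 0 R) := by
    have := intervalIntegral.intervalIntegrable_rpow' (a := 0) (b := R) (r := -b) (by linarith)
    rwa [intervalIntegrable_iff_integrableOn_Ioc_of_le hR.le] at this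
  have h2 := h1.2
  rw [hasFiniteIntegral_iff_enorm] at h2
  refine lt_of_le_of_lt (le_of_eq ?_) h2
  rw [setLIntegral_indicator measurableSet_Iic, inter_comm, Ioi_inter_Iic]
  apply setLIntegral_congr_fun measurableSet_Ioc
  intro s hs
  simp only
  rw [Real.enorm_eq_ofReal (Real.rpow_nonneg hs.1.le _), ENNReal.ofReal_rpow_of_pos hs.1]

theorem lint_far (b R : ℝ) (hb : 1 < b) (hR : 0 < R) :
    ∫⁻ t : ℝ, (Ioi R).indicator (fun u => ENNReal.ofReal u ^ (-b)) |t| < ∞ := by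
  refine lt_of_le_of_lt (lintegral_abs_le _ (Measurable.indicator (by fun_prop) measurableSet_Ioi)) ?_
  apply ENNReal.mul_lt_top (by simp)
  have h1 : IntegrableOn (fun s : ℝ => s ^ (-b)) (Ioi R) :=
    integrableOn_Ioi_rpow_of_lt (by linarith) hR
  have h2 := h1.2
  rw [hasFiniteIntegral_iff_enorm] at h2
  refine lt_of_le_of_lt (le_of_eq ?_) h2
  rw [setLIntegral_indicator measurableSet_Ioi, inter_comm, Ioi_inter_Ioi]
  rw [sup_of_le_right hR.le]
  apply setLIntegral_congr_fun measurableSet_Ioi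
  intro s hs
  have hs' : 0 < s := hR.trans hs
  simp only
  rw [Real.enorm_eq_ofReal (Real.rpow_nonneg hs'.le _), ENNReal.ofReal_rpow_of_pos hs']

theorem ofReal_rpow_neg_anti {a b c : ℝ} (hab : a ≤ b) (hc : 0 ≤ c) :
    ENNReal.ofReal b ^ (-c) ≤ ENNReal.ofReal a ^ (-c) := by
  rw [ENNReal.rpow_neg, ENNReal.rpow_neg]
  gcongr

theorem lint_kernel (β a : ℝ) (hβ : 0 < β) (hβa : β < a) (ha : a < 1) :
    ∫⁻ t : ℝ, ENNReal.ofReal |1 - t| ^ (β - 1) * ENNReal.ofReal |t| ^ (-a) < ∞ := by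
  have hA := lint_near a (1/2) ha (by norm_num)
  have hB := lint_near (1 - β) 3 (by linarith) (by norm_num)
  have hC := lint_far (1 - β + a) 2 (by linarith) (by norm_num)
  have e : -(1 - β) = β - 1 := by ring
  set gA : ℝ → ℝ≥0∞ := (Iic (1/2:ℝ)).indicator (fun u => ENNReal.ofReal u ^ (-a)) with hgA
  set gB : ℝ → ℝ≥0∞ := (Iic (3:ℝ)).indicator (fun u => ENNReal.ofReal u ^ (-(1 - β))) with hgB
  set gC : ℝ → ℝ≥0∞ := (Ioi (2:ℝ)).indicator (fun u => ENNReal.ofReal u ^ (-(1 - β + a))) with hgC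
  have mA : Measurable gA := Measurable.indicator (by fun_prop) measurableSet_Iic
  have mB : Measurable gB := Measurable.indicator (by fun_prop) measurableSet_Iic
  have mC : Measurable gC := Measurable.indicator (by fun_prop) measurableSet_Ioi
  set cA := ENNReal.ofReal (1/2) ^ (-(1 - β))
  set cB := ENNReal.ofReal (1/2) ^ (-a)
  have hcA : cA ≠ ∞ := by simp [cA, ENNReal.rpow_eq_top_iff]
  have hcB : cB ≠ ∞ := by simp [cB, ENNReal.rpow_eq_top_iff]
  have hle : ∀ t : ℝ, ENNReal.ofReal |1 - t| ^ (β - 1) * ENNReal.ofReal |t| ^ (-a) ≤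
      cA * gA |t| + (gB |1 - t| * cB + cA * gC |t|) := by
    intro t
    rw [← e]
    by_cases h1 : |t| ≤ 1/2
    · refine le_trans ?_ le_self_add
      simp only [hgA]
      rw [indicator_of_mem (show |t| ∈ Iic (1/2) from h1)]
      gcongr
      apply ofReal_rpow_neg_anti _ (by linarith)
      have := abs_sub_abs_le_abs_sub 1 t
      rw [abs_one] at this
      linarith
    · push Not at h1
      refine le_trans ?_ le_add_self
      by_cases h2 : |1 - t| ≤ 3
      · refine le_trans ?_ le_self_add
        simp only [hgB]
        rw [indicator_of_mem (show |1 - t| ∈ Iic 3 from h2)]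
        gcongr
        exact ofReal_rpow_neg_anti h1.le (by linarith)
      · push Not at h2
        refine le_trans ?_ le_add_self
        have h4 : |1 - t| ≤ 1 + |t| := by
          have := abs_sub 1 t
          rwa [abs_one] at this
        have h5 := abs_sub_abs_le_abs_sub t 1
        rw [abs_one, abs_sub_comm] at h5
        have h3 : 2 < |t| := by linarith
        simp only [hgC]
        rw [indicator_of_mem (show |t| ∈ Ioi 2 from h3), neg_add, ENNReal.rpow_add _ _ (by simp; intro h; norm_num [h] at h3) (by simp),
          ← mul_assoc]
        gcongr
        rw [← ENNReal.mul_rpow_of_ne_top (by simp) (by simp), ← ENNReal.ofReal_mul (by norm_num)]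
        apply ofReal_rpow_neg_anti _ (by linarith)
        linarith
  refine lt_of_le_of_lt (lintegral_mono hle) ?_
  have hB' : ∫⁻ t, gB |1 - t| < ∞ := by
    rw [lintegral_sub_left_eq_self (fun t => gB |t|) 1]
    exact hB
  rw [lintegral_add_left (by fun_prop), lintegral_add_left (by fun_prop), lintegral_const_mul' _ _ hcA,
    lintegral_mul_const' _ _ hcB, lintegral_const_mul' _ _ hcA]
  simp only [ENNReal.add_lt_top]
  exact ⟨ENNReal.mul_lt_top hcA.lt_top hA, ENNReal.mul_lt_top hB' hcB.lt_top, ENNReal.mul_lt_top hcA.lt_top hC⟩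

theorem ae_coord_ne {ι : Type*} [Fintype ι] (c : ℝ) : ∀ᵐ t : ι → ℝ, ∀ l, t l ≠ c := by
  rw [ae_all_iff]
  intro l
  exact Measure.ae_eval_ne (μ := fun _ : ι => (volume : Measure ℝ)) l c

theorem lint_prod_lt_top {ι : Type*} [Fintype ι] (g : ι → ℝ → ℝ≥0∞) (hg : ∀ l, Measurable (g l))
    (hfin : ∀ l, ∫⁻ t, g l t < ∞) : ∫⁻ t : ι → ℝ, ∏ l, g l (t l) < ∞ := by
  have hae : ∀ l, ∀ᵐ t : ℝ, g l t ≠ ∞ := fun l => by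
    filter_upwards [ae_lt_top (hg l) (hfin l).ne] with t ht using ht.ne
  have hintegr : ∀ l, Integrable (fun t => (g l t).toReal) := fun l =>
    integrable_toReal_of_lintegral_ne_top (hg l).aemeasurable (hfin l).ne
  have h1 := (Integrable.fintype_prod (𝕜 := ℝ) (f := fun l t => (g l t).toReal) (μ := fun _ => volume) hintegr).2
  rw [hasFiniteIntegral_iff_enorm] at h1
  refine lt_of_le_of_lt (lintegral_mono_ae ?_) h1
  have hae' : ∀ᵐ t : ι → ℝ, ∀ l, g l (t l) ≠ ∞ := by
    rw [ae_all_iff]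
    intro l
    exact (Measure.quasiMeasurePreserving_eval (fun _ : ι => (volume : Measure ℝ)) l).ae (hae l)
  filter_upwards [hae'] with t ht
  rw [Real.enorm_eq_ofReal (Finset.prod_nonneg fun _ _ => ENNReal.toReal_nonneg),
    ENNReal.ofReal_prod_of_nonneg fun _ _ => ENNReal.toReal_nonneg]
  apply le_of_eq
  exact Finset.prod_congr rfl fun l _ => (ENNReal.ofReal_toReal (ht l)).symm

theorem lintegral_diag {ι : Type*} [Fintype ι] (x : ι → ℝ) (hx : ∀ l, x l ≠ 0)
    (Φ : (ι → ℝ) → ℝ≥0∞) (hΦ : Measurable Φ) :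
    ∫⁻ y, Φ y = (∏ l, ENNReal.ofReal |x l|) * ∫⁻ t : ι → ℝ, Φ (fun l => x l * t l) := by
  classical
  have hdet : (Matrix.diagonal x).det ≠ 0 := by
    rw [Matrix.det_diagonal]
    exact Finset.prod_ne_zero_iff.2 fun l _ => hx l
  have h := Real.smul_map_diagonal_volume_pi hdet
  rw [Matrix.det_diagonal, Finset.abs_prod, ENNReal.ofReal_prod_of_nonneg (fun _ _ => abs_nonneg _)] at h
  conv_lhs => rw [← h]
  rw [lintegral_smul_measure, smul_eq_mul, lintegral_map hΦ]
  · congr 1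
    apply lintegral_congr
    intro t
    congr 1
    ext l
    simp [Matrix.mulVec_diagonal]
  · exact (LinearMap.continuous_of_finiteDimensional _).measurable

/-- Currying as a measurable equivalence. -/
def curryE (i : ℕ) (k : Fin i → ℕ) : ((Σ j, Fin (k j)) → ℝ) ≃ᵐ (∀ j : Fin i, Fin (k j) → ℝ) :=
  MeasurableEquiv.piCurry (fun (_ : Fin i) _ => ℝ)

theorem curryE_apply (i : ℕ) (k : Fin i → ℕ) (u : (Σ j, Fin (k j)) → ℝ) (j : Fin i) (l : Fin (k j)) :
    curryE i k u j l = u ⟨j, l⟩ := rfl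

theorem curryE_mp (i : ℕ) (k : Fin i → ℕ) : MeasurePreserving (curryE i k) volume volume := by
  apply MeasurePreserving.symm (curryE i k).symm
  refine ⟨(curryE i k).symm.measurable, ?_⟩
  symm
  apply Measure.pi_eq
  intro s hs
  rw [MeasurableEquiv.map_apply]
  have : (curryE i k).symm ⁻¹' (univ.pi s) = univ.pi (fun j => univ.pi fun l => s ⟨j, l⟩) := by
    ext y
    simp only [mem_preimage, mem_pi, mem_univ, true_implies, Sigma.forall]
    rfl
  rw [this, volume_pi, Measure.pi_pi, Fintype.prod_sigma]
  simp only [volume_pi_pi]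


/-- The Euclidean pairing on the structured domain. -/
def gpair {i : ℕ} {k : Fin i → ℕ} {m : ℕ} (ξ x : GrpDom i k m) : ℝ :=
  (∑ j, ∑ l, ξ.1 j l * x.1 j l) + ∑ a, ξ.2 a * x.2 a

/-- The normalising constant of `grpFt`. -/
def gcst (i : ℕ) (k : Fin i → ℕ) (m : ℕ) : ℝ :=
  (2 * π) ^ (-((((∑ j, k j) + m : ℕ)) : ℝ) / 2)

theorem gcst_pos (i : ℕ) (k : Fin i → ℕ) (m : ℕ) : 0 < gcst i k m :=
  Real.rpow_pos_of_pos (by positivity) _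

theorem grpFt_eq (i : ℕ) (k : Fin i → ℕ) (m : ℕ) (f : GrpDom i k m → ℂ) (ξ : GrpDom i k m) :
    grpFt i k m f ξ = (gcst i k m : ℂ) *
      ∫ x : GrpDom i k m, Complex.exp (-(Complex.I * (gpair ξ x : ℂ))) * f x := rfl

/-- Linear identification with a Euclidean space. -/
def toEucLin (i : ℕ) (k : Fin i → ℕ) (m : ℕ) :
    GrpDom i k m ≃ₗ[ℝ] EuclideanSpace ℝ ((Σ j, Fin (k j)) ⊕ Fin m) where
  toFun x := WithLp.toLp 2 (Sum.elim (fun p => x.1 p.1 p.2) x.2)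
  invFun y := (fun j l => y (Sum.inl ⟨j, l⟩), fun a => y (Sum.inr a))
  map_add' x y := by
    ext (p | a) <;> rfl
  map_smul' c y := by
    ext (p | a) <;> rfl
  left_inv x := rfl
  right_inv y := by
    ext (p | a) <;> rfl

/-- Continuous linear version. -/
def toEuc (i : ℕ) (k : Fin i → ℕ) (m : ℕ) :
    GrpDom i k m ≃L[ℝ] EuclideanSpace ℝ ((Σ j, Fin (k j)) ⊕ Fin m) :=
  (toEucLin i k m).toContinuousLinearEquiv

theorem inner_toEuc (i : ℕ) (k : Fin i → ℕ) (m : ℕ) (x ξ : GrpDom i k m) :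
    inner ℝ (toEuc i k m x) (toEuc i k m ξ) = gpair ξ x := by
  rw [PiLp.inner_apply, Fintype.sum_sum_type, Fintype.sum_sigma]
  rfl

theorem toEuc_mp (i : ℕ) (k : Fin i → ℕ) (m : ℕ) :
    MeasurePreserving (toEuc i k m) volume volume := by
  have h1 : MeasurePreserving (fun x : GrpDom i k m => ((curryE i k).symm x.1, x.2))
      volume volume :=
    MeasurePreserving.prod (MeasurePreserving.symm _ (curryE_mp i k)) (MeasurePreserving.id volume)
  have h2 := volume_measurePreserving_sumPiEquivProdPi_symm
    (fun _ : (Σ j, Fin (k j)) ⊕ Fin m => ℝ)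
  have h3 := PiLp.volume_preserving_toLp ((Σ j, Fin (k j)) ⊕ Fin m)
  have h := h3.comp (h2.comp h1)
  have he : (toEuc i k m : GrpDom i k m → EuclideanSpace ℝ ((Σ j, Fin (k j)) ⊕ Fin m)) =
      WithLp.toLp 2 ∘ ((MeasurableEquiv.sumPiEquivProdPi
        (fun _ : (Σ j, Fin (k j)) ⊕ Fin m => ℝ)).symm ∘
          fun x : GrpDom i k m => ((curryE i k).symm x.1, x.2)) := by
    funext x
    ext (p | a) <;> rfl
  rw [he]
  exact h

theorem toEuc_integral (i : ℕ) (k : Fin i → ℕ) (m : ℕ)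
    (g : EuclideanSpace ℝ ((Σ j, Fin (k j)) ⊕ Fin m) → ℂ) :
    ∫ x, g (toEuc i k m x) = ∫ y, g y :=
  (toEuc_mp i k m).integral_comp (toEuc i k m).toHomeomorph.measurableEmbedding g

theorem gpair_smul {i : ℕ} {k : Fin i → ℕ} {m : ℕ} (c : ℝ) (ξ x : GrpDom i k m) :
    gpair (c • ξ) x = c * gpair ξ x := by
  rw [← inner_toEuc, ← inner_toEuc, map_smul, inner_smul_right]

theorem gpair_neg {i : ℕ} {k : Fin i → ℕ} {m : ℕ} (ξ x : GrpDom i k m) :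
    gpair (-ξ) x = - gpair ξ x := by
  rw [← inner_toEuc, ← inner_toEuc, map_neg, inner_neg_right]

theorem gpair_comm {i : ℕ} {k : Fin i → ℕ} {m : ℕ} (ξ x : GrpDom i k m) :
    gpair ξ x = gpair x ξ := by
  rw [← inner_toEuc, ← inner_toEuc, real_inner_comm]

theorem fourier_facts (i : ℕ) (k : Fin i → ℕ) (m : ℕ) :
    ∃ c1 : ℂ, c1 ≠ 0 ∧ ∀ f : GrpDom i k m → ℂ,
      ContDiff ℝ (⊤ : ℕ∞) f → HasCompactSupport f →
      (∃ Θ : SchwartzMap (GrpDom i k m) ℂ, ∀ ξ, grpFt i k m f ξ = Θ ξ) ∧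
      ∀ x, grpFt i k m (grpFt i k m f) (-x) = c1 * f x := by
  set T := toEuc i k m with hT
  set d := Module.finrank ℝ (EuclideanSpace ℝ ((Σ j, Fin (k j)) ⊕ Fin m))
  have hc := (gcst_pos i k m).ne'
  have hpi : (2 * π) ≠ 0 := by positivity
  refine ⟨(gcst i k m : ℂ) * (gcst i k m : ℂ) * ((|(((2 * π)⁻¹) ^ d)⁻¹| : ℝ) : ℂ), ?_, ?_⟩
  · refine mul_ne_zero (mul_ne_zero ?_ ?_) ?_
    · exact_mod_cast hc
    · exact_mod_cast hc
    · exact_mod_cast abs_ne_zero.2 (inv_ne_zero (pow_ne_zero _ (inv_ne_zero hpi)))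
  intro f hf hs
  have hs' : HasCompactSupport (f ∘ T.symm) := hs.comp_homeomorph T.symm.toHomeomorph
  have hf' : ContDiff ℝ (⊤ : ℕ∞) (f ∘ T.symm) := hf.comp T.symm.contDiff
  set φ : SchwartzMap (EuclideanSpace ℝ ((Σ j, Fin (k j)) ⊕ Fin m)) ℂ := hs'.toSchwartzMap hf' with hφ
  have hφv : ∀ x, φ (T x) = f x := fun x => by
    change f (T.symm (T x)) = f x
    simp
  set ψ := FourierTransform.fourier φ with hψ
  have key : ∀ ξ, grpFt i k m f ξ = (gcst i k m : ℂ) * ψ ((2 * π)⁻¹ • T ξ) := by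
    intro ξ
    rw [grpFt_eq, hψ, SchwartzMap.fourier_coe, Real.fourier_eq', ← toEuc_integral]
    congr 1
    apply integral_congr_ae
    refine Filter.Eventually.of_forall fun x => ?_
    simp only
    rw [← hT, hφv, smul_eq_mul, inner_smul_right, inner_toEuc]
    congr 2
    have : -2 * π * ((2 * π)⁻¹ * gpair ξ x) = - gpair ξ x := by field_simp
    rw [this]
    push_cast
    ring
  refine ⟨?_, ?_⟩
  · set S : GrpDom i k m ≃L[ℝ] GrpDom i k m := ContinuousLinearEquiv.smulLeft (Units.mk0 ((2 * π)⁻¹) (inv_ne_zero hpi))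
    refine ⟨(gcst i k m : ℂ) • SchwartzMap.compCLMOfContinuousLinearEquiv ℂ (S.trans T) ψ, fun ξ => ?_⟩
    rw [key]
    rw [smul_apply, smul_eq_mul]
    congr 1
    change _ = ψ (T ((2 * π)⁻¹ • ξ))
    rw [T.map_smul]
  · intro x
    rw [grpFt_eq]
    have h1 : ∀ ξ : GrpDom i k m, Complex.exp (-(Complex.I * (gpair (-x) ξ : ℂ))) * grpFt i k m f ξ
        = (gcst i k m : ℂ) * (fun w => Complex.exp (((2 * π * inner ℝ w (T x) : ℝ) : ℂ) * Complex.I) • ψ w)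
          ((2 * π)⁻¹ • T ξ) := by
      intro ξ
      simp only
      rw [key, inner_smul_left, inner_toEuc, gpair_neg, smul_eq_mul]
      have : 2 * π * ((starRingEnd ℝ) (2 * π)⁻¹ * gpair x ξ) = gpair x ξ := by
        simp only [conj_trivial]
        field_simp
      rw [this]
      push_cast
      rw [mul_left_comm]
      congr 3
      ring
    simp_rw [h1]
    rw [integral_const_mul]
    rw [toEuc_integral i k m (fun y => (fun w => Complex.exp (((2 * π * inner ℝ w (T x) : ℝ) : ℂ) * Complex.I) • ψ w)
          ((2 * π)⁻¹ • y)), Measure.integral_comp_smul volume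
          (fun w => Complex.exp (((2 * π * inner ℝ w (T x) : ℝ) : ℂ) * Complex.I) • ψ w), ← Real.fourierInv_eq', ← SchwartzMap.fourierInv_coe, hψ,
          FourierTransform.fourierInv_fourier_eq, hφv, Complex.real_smul]
    ring


theorem grpDom_haar (i : ℕ) (k : Fin i → ℕ) (m : ℕ) :
    (volume : Measure (GrpDom i k m)).IsAddHaarMeasure := by
  exact Measure.prod.instIsAddHaarMeasure volume volume

/-- Squared Euclidean norm on the grouped variables. -/
def qf {i : ℕ} {k : Fin i → ℕ} (v : ∀ j : Fin i, Fin (k j) → ℝ) : ℝ := ∑ j, ∑ l, v j l ^ 2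

/-- Pairing on the grouped variables. -/
def vpair {i : ℕ} {k : Fin i → ℕ} (v w : ∀ j : Fin i, Fin (k j) → ℝ) : ℝ :=
  ∑ j, ∑ l, v j l * w j l

theorem qf_nonneg {i : ℕ} {k : Fin i → ℕ} (v : ∀ j : Fin i, Fin (k j) → ℝ) : 0 ≤ qf v := by
  unfold qf; positivity

theorem sq_le_qf {i : ℕ} {k : Fin i → ℕ} (v : ∀ j : Fin i, Fin (k j) → ℝ) (j : Fin i)
    (l : Fin (k j)) : v j l ^ 2 ≤ qf v := by
  unfold qf
  refine le_trans ?_ (Finset.single_le_sum (f := fun j => ∑ l, v j l ^ 2)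
    (fun j _ => by positivity) (Finset.mem_univ j))
  exact Finset.single_le_sum (f := fun l => v j l ^ 2) (fun l _ => by positivity) (Finset.mem_univ l)

theorem continuous_qf {i : ℕ} {k : Fin i → ℕ} :
    Continuous (qf : (∀ j : Fin i, Fin (k j) → ℝ) → ℝ) := by
  unfold qf; fun_prop

theorem continuous_vpair {i : ℕ} {k : Fin i → ℕ} (w : ∀ j : Fin i, Fin (k j) → ℝ) :
    Continuous (fun v => vpair v w) := by
  unfold vpair; fun_prop

theorem card_sig (i : ℕ) (k : Fin i → ℕ) : Fintype.card (Σ j, Fin (k j)) = ∑ j, k j := by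
  simp

theorem gauss_integrable {i : ℕ} {k : Fin i → ℕ} (u : ℝ) (hu : 0 < u)
    (x : ∀ j : Fin i, Fin (k j) → ℝ) :
    Integrable (fun y : ∀ j : Fin i, Fin (k j) → ℝ => Real.exp (-(qf (x - y) / (4 * u)))) := by
  have h0 : Integrable (fun y : ∀ j : Fin i, Fin (k j) → ℝ => Real.exp (-(qf y / (4 * u)))) := by
    rw [← (curryE_mp i k).integrable_comp_emb (curryE i k).measurableEmbedding]
    have hb : 0 < (((1 / (4 * u) : ℝ)) : ℂ).re := by
      rw [Complex.ofReal_re]; positivity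
    have h := (GaussianFourier.integrable_cexp_neg_mul_sum_add (ι := Σ j, Fin (k j)) hb 0).norm
    refine h.congr (Filter.Eventually.of_forall fun v => ?_)
    simp only [Function.comp, Complex.norm_exp, Pi.zero_apply, zero_mul, Finset.sum_const_zero, add_zero]
    congr 1
    have : (-(((1 / (4 * u) : ℝ)) : ℂ) * ∑ p : (Σ j, Fin (k j)), ((v p : ℝ) : ℂ) ^ 2)
        = ((-((1 / (4 * u))) * ∑ p : (Σ j, Fin (k j)), v p ^ 2 : ℝ) : ℂ) := by push_cast; ring
    rw [this, Complex.ofReal_re, Fintype.sum_sigma]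
    unfold qf
    simp only [curryE_apply]
    ring
  have h1 := h0.comp_add_right (-x)
  refine h1.congr (Filter.Eventually.of_forall fun y => ?_)
  simp only
  congr 3
  unfold qf
  refine Finset.sum_congr rfl fun j _ => Finset.sum_congr rfl fun l _ => ?_
  simp only [Pi.add_apply, Pi.sub_apply, Pi.neg_apply]
  ring

theorem gauss_V {i : ℕ} {k : Fin i → ℕ} (u : ℝ) (hu : 0 < u) (x ξ : ∀ j : Fin i, Fin (k j) → ℝ) :
    ∫ y : ∀ j : Fin i, Fin (k j) → ℝ,
      ((Real.exp (-(qf (x - y) / (4 * u))) : ℝ) : ℂ) * Complex.exp (Complex.I * (vpair y ξ : ℂ)) =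
    (((4 * π * u) ^ (((∑ j, k j : ℕ) : ℝ) / 2) : ℝ) : ℂ) * (Complex.exp (Complex.I * (vpair x ξ : ℂ))
      * ((Real.exp (-(u * qf ξ)) : ℝ) : ℂ)) := by
  rw [← integral_add_right_eq_self _ x, ← (curryE_mp i k).integral_comp (curryE i k).measurableEmbedding]
  have hb : 0 < (((1 / (4 * u) : ℝ)) : ℂ).re := by
      rw [Complex.ofReal_re]; positivity
  have h := GaussianFourier.integral_cexp_neg_mul_sum_add (ι := Σ j, Fin (k j)) hb
    (fun p => Complex.I * (ξ p.1 p.2 : ℂ))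
  have e1 : ∀ v : (Σ j, Fin (k j)) → ℝ,
      ((Real.exp (-(qf (x - (curryE i k v + x)) / (4 * u))) : ℝ) : ℂ) *
        Complex.exp (Complex.I * (vpair (curryE i k v + x) ξ : ℂ)) =
      Complex.exp (Complex.I * (vpair x ξ : ℂ)) *
      Complex.exp (-(((1 / (4 * u) : ℝ)) : ℂ) * ∑ p : (Σ j, Fin (k j)), ((v p : ℝ) : ℂ) ^ 2 +
        ∑ p : (Σ j, Fin (k j)), Complex.I * (ξ p.1 p.2 : ℂ) * (v p : ℂ)) := by
    intro v
    rw [Complex.ofReal_exp, ← Complex.exp_add, ← Complex.exp_add]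
    congr 1
    have a1 : qf (x - (curryE i k v + x)) = ∑ p : (Σ j, Fin (k j)), v p ^ 2 := by
      unfold qf
      rw [Fintype.sum_sigma]
      refine Finset.sum_congr rfl fun j _ => Finset.sum_congr rfl fun l _ => ?_
      simp only [Pi.add_apply, Pi.sub_apply, curryE_apply]
      ring
    have a2 : vpair (curryE i k v + x) ξ = vpair x ξ + ∑ p : (Σ j, Fin (k j)), ξ p.1 p.2 * v p := by
      unfold vpair
      rw [Fintype.sum_sigma, ← Finset.sum_add_distrib]
      refine Finset.sum_congr rfl fun j _ => ?_
      rw [← Finset.sum_add_distrib]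
      refine Finset.sum_congr rfl fun l _ => ?_
      simp only [Pi.add_apply, curryE_apply]
      ring
    rw [a1, a2]
    simp only [mul_assoc]
    rw [← Finset.mul_sum]
    push_cast
    ring
  simp_rw [e1]
  rw [integral_const_mul, h, card_sig]
  have e2 : ((π : ℂ) / (((1 / (4 * u) : ℝ)) : ℂ)) ^ ((((∑ j, k j : ℕ)) : ℂ) / 2)
      = (((4 * π * u) ^ (((∑ j, k j : ℕ) : ℝ) / 2) : ℝ) : ℂ) := by
    rw [Complex.ofReal_cpow (by positivity)]
    congr 1
    · push_cast
      field_simp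
    · push_cast; rfl
  have e3 : Complex.exp ((∑ p : (Σ j, Fin (k j)), (Complex.I * (ξ p.1 p.2 : ℂ)) ^ 2) /
      (4 * (((1 / (4 * u) : ℝ)) : ℂ))) = ((Real.exp (-(u * qf ξ)) : ℝ) : ℂ) := by
    rw [Complex.ofReal_exp]
    congr 1
    unfold qf
    simp only [mul_pow, Complex.I_sq]
    rw [← Finset.mul_sum, Fintype.sum_sigma]
    push_cast
    have : (u : ℂ) ≠ 0 := by exact_mod_cast hu.ne'
    field_simp
  rw [e2, e3]
  ring

theorem ker_int (a R : ℝ) (ha : 0 < a) (hR : 0 < R) :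
    ∫⁻ u in Ioi (0 : ℝ), ENNReal.ofReal (u ^ (-a - 1) * Real.exp (-(R / (4 * u)))) =
      ENNReal.ofReal ((4 / R) ^ a * Real.Gamma a) := by
  have h1 := Real.integral_rpow_mul_exp_neg_mul_Ioi (a := a) (r := R / 4) ha (by positivity)
  have hi : IntegrableOn (fun t : ℝ => t ^ (a - 1) * Real.exp (-(R / 4 * t))) (Ioi 0) := by
    have := integrableOn_rpow_mul_exp_neg_mul_rpow (p := 1) (s := a - 1) (b := R / 4)
      (by linarith) one_pos (by positivity)
    simpa only [Real.rpow_one, neg_mul] using this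
  have e : ∀ u ∈ Ioi (0 : ℝ), u ^ (-a - 1) * Real.exp (-(R / (4 * u))) =
      (|(-1 : ℝ)| * u ^ ((-1 : ℝ) - 1)) • ((fun t : ℝ => t ^ (a - 1) * Real.exp (-(R / 4 * t))) (u ^ (-1 : ℝ))) := by
    intro u hu
    have hu' : 0 < u := hu
    simp only [abs_neg, abs_one, one_mul, smul_eq_mul]
    rw [← rpow_mul hu'.le, ← mul_assoc, ← rpow_add hu', Real.rpow_neg_one]
    congr 2
    · ring
    · field_simp
  have hi2 := (integrableOn_Ioi_comp_rpow_iff (fun t : ℝ => t ^ (a - 1) * Real.exp (-(R / 4 * t)))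
    (p := -1) (by norm_num)).2 hi
  rw [← integral_comp_rpow_Ioi _ (p := -1) (by norm_num)] at h1
  rw [setLIntegral_congr_fun measurableSet_Ioi (fun u hu => by rw [e u hu]),
    ← ofReal_integral_eq_lintegral_ofReal hi2, h1]
  · congr 3
    rw [one_div_div]
  · filter_upwards [ae_restrict_mem measurableSet_Ioi] with u hu
    rw [← e u hu]
    have hu' : 0 < u := hu
    simp only [Pi.zero_apply]
    positivity


theorem qf_le_norm {i : ℕ} {k : Fin i → ℕ} (v : ∀ j : Fin i, Fin (k j) → ℝ) :
    qf v ≤ ((∑ j, k j : ℕ) : ℝ) * ‖v‖ ^ 2 := by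
  unfold qf
  have : ∀ j l, v j l ^ 2 ≤ ‖v‖ ^ 2 := by
    intro j l
    rw [← sq_abs, ← Real.norm_eq_abs]
    have := (norm_le_pi_norm (v j) l).trans (norm_le_pi_norm v j)
    gcongr
  refine (Finset.sum_le_sum fun j _ => Finset.sum_le_sum fun l _ => this j l).trans ?_
  simp [Finset.sum_mul]

theorem h_integrable {i : ℕ} {k : Fin i → ℕ} {m : ℕ} (s : ℝ) (hs : 0 < s)
    (Θ : SchwartzMap (GrpDom i k m) ℂ) :
    Integrable (fun ξ : GrpDom i k m => ((qf ξ.1 ^ (s / 2) : ℝ) : ℂ) * Θ ξ) := by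
  have := grpDom_haar i k m
  set K : ℝ := ((∑ j, k j : ℕ) : ℝ)
  have hK : 0 ≤ K := Nat.cast_nonneg _
  obtain ⟨N, hN⟩ := exists_nat_ge s
  have h1 : Integrable (fun ξ : GrpDom i k m => K ^ (s / 2) * (‖ξ‖ ^ 0 * ‖Θ ξ‖ + ‖ξ‖ ^ N * ‖Θ ξ‖)) :=
    ((Θ.integrable_pow_mul volume 0).add (Θ.integrable_pow_mul volume N)).const_mul _
  refine h1.mono' ?_ (Filter.Eventually.of_forall fun ξ => ?_)
  · refine Continuous.aestronglyMeasurable ?_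
    refine Continuous.mul ?_ Θ.continuous
    refine Complex.continuous_ofReal.comp ?_
    exact (continuous_qf.comp continuous_fst).rpow_const fun _ => Or.inr (by positivity)
  · have h2 : qf ξ.1 ^ (s / 2) ≤ K ^ (s / 2) * ‖ξ‖ ^ s := by
      have h3 : qf ξ.1 ≤ K * ‖ξ‖ ^ 2 := (qf_le_norm ξ.1).trans (by
        have := norm_fst_le ξ
        gcongr)
      refine (Real.rpow_le_rpow (qf_nonneg _) h3 (by positivity)).trans ?_
      rw [Real.mul_rpow hK (by positivity), ← Real.rpow_natCast, ← Real.rpow_mul (norm_nonneg _)]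
      apply le_of_eq
      congr 2
      push_cast
      ring
    have h4 : ‖ξ‖ ^ s ≤ ‖ξ‖ ^ 0 + ‖ξ‖ ^ N := by
      rcases le_total ‖ξ‖ 1 with h | h
      · have := Real.rpow_le_one (norm_nonneg ξ) h hs.le
        have : 0 ≤ ‖ξ‖ ^ N := by positivity
        simp only [pow_zero]
        linarith
      · have : ‖ξ‖ ^ s ≤ ‖ξ‖ ^ N := by
          rw [← Real.rpow_natCast]
          exact Real.rpow_le_rpow_of_exponent_le h hN
        simp only [pow_zero]
        linarith
    rw [norm_mul, Complex.norm_real, Real.norm_eq_abs, abs_of_nonneg (Real.rpow_nonneg (qf_nonneg _) _),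
      ← add_mul, ← mul_assoc]
    gcongr
    exact h2.trans (by gcongr)

theorem fracLap_form {i : ℕ} {k : Fin i → ℕ} {m : ℕ} (s : ℝ) (f : GrpDom i k m → ℂ)
    (Θ : SchwartzMap (GrpDom i k m) ℂ) (hΘ : ∀ ξ, grpFt i k m f ξ = Θ ξ) (x : GrpDom i k m) :
    grpFracLap i k m s f x = (gcst i k m : ℂ) * ∫ ξ : GrpDom i k m,
      Complex.exp (Complex.I * (gpair x ξ : ℂ)) * (((qf ξ.1 ^ (s / 2) : ℝ) : ℂ) * Θ ξ) := by
  unfold grpFracLap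
  rw [grpFt_eq]
  congr 1
  apply integral_congr_ae
  refine Filter.Eventually.of_forall fun ξ => ?_
  simp only
  rw [gpair_neg, hΘ]
  congr 2
  push_cast
  ring

theorem continuous_gpair {i : ℕ} {k : Fin i → ℕ} {m : ℕ} :
    Continuous (fun p : GrpDom i k m × GrpDom i k m => gpair p.1 p.2) := by
  unfold gpair; fun_prop

theorem norm_phase (t : ℝ) : ‖Complex.exp (Complex.I * (t : ℂ))‖ = 1 := by
  rw [mul_comm]; exact Complex.norm_exp_ofReal_mul_I t

theorem fourier_cont {i : ℕ} {k : Fin i → ℕ} {m : ℕ} (h : GrpDom i k m → ℂ) (hh : Integrable h) :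
    Continuous (fun x => ∫ ξ : GrpDom i k m, Complex.exp (Complex.I * (gpair x ξ : ℂ)) * h ξ) := by
  refine continuous_of_dominated (bound := fun ξ => ‖h ξ‖) ?_ ?_ hh.norm ?_
  · intro x
    refine AEStronglyMeasurable.mul ?_ hh.aestronglyMeasurable
    refine Continuous.aestronglyMeasurable ?_
    have : Continuous (fun ξ => gpair x ξ) := continuous_gpair.comp (by fun_prop : Continuous fun ξ => (x, ξ))
    fun_prop
  · intro x
    refine Filter.Eventually.of_forall fun ξ => ?_
    rw [norm_mul, norm_phase, one_mul]
  · refine Filter.Eventually.of_forall fun ξ => ?_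
    have : Continuous (fun x => gpair x ξ) := continuous_gpair.comp (by fun_prop : Continuous fun x => (x, ξ))
    fun_prop

theorem gpair_split {i : ℕ} {k : Fin i → ℕ} {m : ℕ} (y : ∀ j : Fin i, Fin (k j) → ℝ)
    (z : Fin m → ℝ) (ξ : GrpDom i k m) :
    gpair (y, z) ξ = vpair y ξ.1 + ∑ a, z a * ξ.2 a := rfl

theorem gauss_fubini {i : ℕ} {k : Fin i → ℕ} {m : ℕ} (h : GrpDom i k m → ℂ) (hh : Integrable h)
    (u : ℝ) (hu : 0 < u) (x : ∀ j : Fin i, Fin (k j) → ℝ) (z : Fin m → ℝ) :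
    ∫ y : ∀ j : Fin i, Fin (k j) → ℝ, ((Real.exp (-(qf (x - y) / (4 * u))) : ℝ) : ℂ) *
      ∫ ξ : GrpDom i k m, Complex.exp (Complex.I * (gpair (y, z) ξ : ℂ)) * h ξ =
    (((4 * π * u) ^ (((∑ j, k j : ℕ) : ℝ) / 2) : ℝ) : ℂ) *
      ∫ ξ : GrpDom i k m, Complex.exp (Complex.I * (gpair (x, z) ξ : ℂ)) *
        (((Real.exp (-(u * qf ξ.1)) : ℝ) : ℂ) * h ξ) := by
  have h0 := ((gauss_integrable u hu x).ofReal (𝕜 := ℂ)).mul_prod hh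
  have hintegr : Integrable (Function.uncurry fun (y : ∀ j : Fin i, Fin (k j) → ℝ) (ξ : GrpDom i k m) =>
      ((Real.exp (-(qf (x - y) / (4 * u))) : ℝ) : ℂ) *
        (Complex.exp (Complex.I * (gpair (y, z) ξ : ℂ)) * h ξ)) (volume.prod volume) := by
    have h1 := h0.bdd_mul (c := 1)
      (f := fun p : (∀ j : Fin i, Fin (k j) → ℝ) × GrpDom i k m =>
        Complex.exp (Complex.I * (gpair (p.1, z) p.2 : ℂ))) ?_ ?_
    · refine h1.congr (Filter.Eventually.of_forall fun p => ?_)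
      simp only [Function.uncurry]
      exact mul_left_comm _ _ _
    · refine Continuous.aestronglyMeasurable ?_
      have : Continuous (fun p : (∀ j : Fin i, Fin (k j) → ℝ) × GrpDom i k m => gpair (p.1, z) p.2) :=
        continuous_gpair.comp (by fun_prop : Continuous fun p :
          (∀ j : Fin i, Fin (k j) → ℝ) × GrpDom i k m => ((p.1, z), p.2))
      fun_prop
    · refine Filter.Eventually.of_forall fun p => ?_
      rw [norm_phase]
  simp_rw [← integral_const_mul]
  rw [integral_integral_swap hintegr]
  apply integral_congr_ae
  refine Filter.Eventually.of_forall fun ξ => ?_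
  simp only
  have e : ∀ y : ∀ j : Fin i, Fin (k j) → ℝ, ((Real.exp (-(qf (x - y) / (4 * u))) : ℝ) : ℂ) *
        (Complex.exp (Complex.I * (gpair (y, z) ξ : ℂ)) * h ξ) =
      (((Real.exp (-(qf (x - y) / (4 * u))) : ℝ) : ℂ) * Complex.exp (Complex.I * (vpair y ξ.1 : ℂ))) *
       (Complex.exp (Complex.I * ((∑ a, z a * ξ.2 a : ℝ) : ℂ)) * h ξ) := by
    intro y
    rw [gpair_split, Complex.ofReal_add, mul_add, Complex.exp_add]
    ring
  simp_rw [e]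
  rw [integral_mul_const, gauss_V u hu, gpair_split, Complex.ofReal_add, mul_add, Complex.exp_add]
  ring


theorem ae_qf_pos {i : ℕ} {k : Fin i → ℕ} {m : ℕ} (j : Fin i) (l : Fin (k j)) :
    ∀ᵐ ξ : GrpDom i k m, 0 < qf ξ.1 := by
  have h0 : ∀ᵐ t : ℝ, t ≠ 0 := by simp [ae_iff]
  have h1 : ∀ᵐ v : Fin (k j) → ℝ, v l ≠ 0 :=
    (Measure.quasiMeasurePreserving_eval (fun _ : Fin (k j) => (volume : Measure ℝ)) l).ae h0
  have h2 : ∀ᵐ v : (∀ j : Fin i, Fin (k j) → ℝ), v j l ≠ 0 :=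
    (Measure.quasiMeasurePreserving_eval (fun j : Fin i => (volume : Measure (Fin (k j) → ℝ))) j).ae h1
  have h3 : ∀ᵐ ξ : GrpDom i k m, ξ.1 j l ≠ 0 :=
    (Measure.quasiMeasurePreserving_fst (μ := (volume : Measure (∀ j : Fin i, Fin (k j) → ℝ)))
      (ν := (volume : Measure (Fin m → ℝ)))).ae h2
  filter_upwards [h3] with ξ hξ
  exact lt_of_lt_of_le (by positivity) (sq_le_qf ξ.1 j l)

theorem subord {i : ℕ} {k : Fin i → ℕ} {m : ℕ} (j : Fin i) (l : Fin (k j)) (s : ℝ) (hs : 0 < s)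
    (Θ : SchwartzMap (GrpDom i k m) ℂ) (x : GrpDom i k m) :
    ∫ ξ : GrpDom i k m, Complex.exp (Complex.I * (gpair x ξ : ℂ)) * Θ ξ =
    (((Real.Gamma (s / 2))⁻¹ : ℝ) : ℂ) * ∫ u in Ioi (0 : ℝ), ((u ^ (s / 2 - 1) : ℝ) : ℂ) *
      ∫ ξ : GrpDom i k m, Complex.exp (Complex.I * (gpair x ξ : ℂ)) *
        (((Real.exp (-(u * qf ξ.1)) : ℝ) : ℂ) * (((qf ξ.1 ^ (s / 2) : ℝ) : ℂ) * Θ ξ)) := by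
  have := grpDom_haar i k m
  have hG : Real.Gamma (s / 2) ≠ 0 := (Real.Gamma_pos_of_pos (by positivity)).ne'
  have hpg : Continuous (fun ξ => gpair x ξ) :=
    continuous_gpair.comp (by fun_prop : Continuous fun ξ => (x, ξ))
  have hqm : Measurable (fun ξ : GrpDom i k m => qf ξ.1) := (continuous_qf.comp continuous_fst).measurable
  have hker : ∀ q : ℝ, 0 < q → IntegrableOn (fun u : ℝ => u ^ (s / 2 - 1) * Real.exp (-(u * q))) (Ioi 0) := by
    intro q hq
    have := integrableOn_rpow_mul_exp_neg_mul_rpow (p := 1) (s := s / 2 - 1) (b := q)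
      (by linarith) one_pos hq
    refine this.congr_fun (fun u _ => ?_) measurableSet_Ioi
    simp only [Real.rpow_one, neg_mul, mul_comm u q]
  have hval : ∀ q : ℝ, 0 < q → ∫ u in Ioi (0 : ℝ), u ^ (s / 2 - 1) * Real.exp (-(u * q)) =
      Real.Gamma (s / 2) * (q ^ (s / 2))⁻¹ := by
    intro q hq
    have := Real.integral_rpow_mul_exp_neg_mul_Ioi (a := s / 2) (r := q) (by positivity) hq
    simp_rw [mul_comm _ q]
    rw [this, one_div, Real.inv_rpow hq.le, mul_comm]
  set F : ℝ → GrpDom i k m → ℂ := fun u ξ => ((u ^ (s / 2 - 1) * Real.exp (-(u * qf ξ.1)) : ℝ) : ℂ) *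
    (Complex.exp (Complex.I * (gpair x ξ : ℂ)) * (((qf ξ.1 ^ (s / 2) : ℝ) : ℂ) * Θ ξ)) with hF
  have hm : Measurable (Function.uncurry F) := by
    have h1 : Measurable (fun ξ : GrpDom i k m => Θ ξ) := Θ.continuous.measurable
    have h2 := hpg.measurable
    have h1' : Measurable (fun p : ℝ × GrpDom i k m => Θ p.2) := h1.comp measurable_snd
    have h2' : Measurable (fun p : ℝ × GrpDom i k m => gpair x p.2) := h2.comp measurable_snd
    have h3' : Measurable (fun p : ℝ × GrpDom i k m => qf p.2.1) := hqm.comp measurable_snd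
    have h4' : Measurable (fun p : ℝ × GrpDom i k m => p.1 ^ (s / 2 - 1)) := measurable_fst.pow_const _
    unfold Function.uncurry
    simp only [hF]
    refine Measurable.mul (Complex.measurable_ofReal.comp (h4'.mul ?_)) (Measurable.mul ?_
      (Measurable.mul (Complex.measurable_ofReal.comp (h3'.pow_const _)) h1'))
    · exact Real.measurable_exp.comp (measurable_fst.mul h3').neg
    · exact Complex.measurable_exp.comp ((Complex.measurable_ofReal.comp h2').const_mul _)
  have hFn : ∀ u ∈ Ioi (0 : ℝ), ∀ ξ, ‖F u ξ‖ = u ^ (s / 2 - 1) * Real.exp (-(u * qf ξ.1)) * ((qf ξ.1 ^ (s / 2)) * ‖Θ ξ‖) := by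
    intro u hu ξ
    have hu' : 0 < u := hu
    simp only [hF]
    rw [norm_mul, norm_mul, norm_mul, norm_phase, one_mul, Complex.norm_real, Complex.norm_real,
      Real.norm_of_nonneg (by positivity), Real.norm_of_nonneg (Real.rpow_nonneg (qf_nonneg _) _)]
  have hintegr : Integrable (Function.uncurry F) ((volume.restrict (Ioi 0)).prod volume) := by
    rw [integrable_prod_iff' hm.aestronglyMeasurable]
    refine ⟨?_, ?_⟩
    · filter_upwards [ae_qf_pos j l] with ξ hξ
      exact ((hker _ hξ).ofReal (𝕜 := ℂ)).mul_const
        (Complex.exp (Complex.I * (gpair x ξ : ℂ)) * (((qf ξ.1 ^ (s / 2) : ℝ) : ℂ) * Θ ξ))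
    · refine (Θ.integrable.norm.const_mul (Real.Gamma (s / 2))).congr ?_
      filter_upwards [ae_qf_pos j l] with ξ hξ
      simp only [Function.uncurry_apply_pair]
      rw [setIntegral_congr_fun (g := fun u => u ^ (s / 2 - 1) * Real.exp (-(u * qf ξ.1)) * ((qf ξ.1 ^ (s / 2)) * ‖Θ ξ‖))
        measurableSet_Ioi (fun u hu => hFn u hu ξ), integral_mul_const, hval _ hξ]
      have : qf ξ.1 ^ (s / 2) ≠ 0 := (Real.rpow_pos_of_pos hξ _).ne'
      field_simp
  have hsw := integral_integral_swap hintegr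
  have e1 : ∀ u : ℝ, ((u ^ (s / 2 - 1) : ℝ) : ℂ) *
      ∫ ξ : GrpDom i k m, Complex.exp (Complex.I * (gpair x ξ : ℂ)) *
        (((Real.exp (-(u * qf ξ.1)) : ℝ) : ℂ) * (((qf ξ.1 ^ (s / 2) : ℝ) : ℂ) * Θ ξ)) = ∫ ξ, F u ξ := by
    intro u
    rw [← integral_const_mul]
    congr 1
    funext ξ
    simp only [hF]
    push_cast
    ring
  simp_rw [e1]
  rw [hsw, ← integral_const_mul]
  apply integral_congr_ae
  filter_upwards [ae_qf_pos j l] with ξ hξ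
  simp only [hF]
  have hval' : ∫ u in Ioi (0 : ℝ), ((u ^ (s / 2 - 1) * Real.exp (-(u * qf ξ.1)) : ℝ) : ℂ) =
      ((Real.Gamma (s / 2) * (qf ξ.1 ^ (s / 2))⁻¹ : ℝ) : ℂ) := by
    rw [← hval _ hξ]
    exact integral_ofReal
  rw [integral_mul_const, hval']
  have : ((qf ξ.1 ^ (s / 2) : ℝ) : ℂ) ≠ 0 := by exact_mod_cast (Real.rpow_pos_of_pos hξ _).ne'
  have hG' : ((Real.Gamma (s / 2) : ℝ) : ℂ) ≠ 0 := by exact_mod_cast hG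
  push_cast
  field_simp

/-- Pointwise Riesz potential bound. -/
theorem riesz_pt (i : ℕ) (k : Fin i → ℕ) (m : ℕ) (j : Fin i) (l : Fin (k j)) (s : ℝ) (hs : 0 < s)
    (hsK : s < ((∑ j, k j : ℕ) : ℝ)) :
    ∃ C : ℝ≥0∞, C ≠ ∞ ∧ ∀ f : GrpDom i k m → ℂ,
      ContDiff ℝ (⊤ : ℕ∞) f → HasCompactSupport f →
      Continuous (grpFracLap i k m s f) ∧
      ∀ (x : ∀ j : Fin i, Fin (k j) → ℝ) (z : Fin m → ℝ),
        ‖f (x, z)‖ₑ ≤ C * ∫⁻ y : ∀ j : Fin i, Fin (k j) → ℝ, ‖grpFracLap i k m s f (y, z)‖ₑ *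
          ENNReal.ofReal (qf (x - y)) ^ (-((((∑ j, k j : ℕ) : ℝ) - s) / 2)) := by
  obtain ⟨c1, hc1, hF⟩ := fourier_facts i k m
  set K : ℝ := ((∑ j, k j : ℕ) : ℝ) with hK
  set a : ℝ := (K - s) / 2 with ha
  have ha0 : 0 < a := by rw [ha]; linarith
  set G : ℝ := (Real.Gamma (s / 2))⁻¹ with hG
  refine ⟨ENNReal.ofReal (‖c1⁻¹‖ * G * (4 * π) ^ (-(K / 2)) * (4 ^ a * Real.Gamma a)), ENNReal.ofReal_ne_top, ?_⟩
  intro f hf hsupp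
  obtain ⟨⟨Θ, hΘ⟩, hinv⟩ := hF f hf hsupp
  have hh := h_integrable s hs Θ
  set h : GrpDom i k m → ℂ := fun ξ => ((qf ξ.1 ^ (s / 2) : ℝ) : ℂ) * Θ ξ with hhdef
  have hg : ∀ x, grpFracLap i k m s f x = (gcst i k m : ℂ) * ∫ ξ : GrpDom i k m,
      Complex.exp (Complex.I * (gpair x ξ : ℂ)) * h ξ := fracLap_form s f Θ hΘ
  have hgc : Continuous (grpFracLap i k m s f) := by
    have : grpFracLap i k m s f = fun x => (gcst i k m : ℂ) * ∫ ξ : GrpDom i k m,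
      Complex.exp (Complex.I * (gpair x ξ : ℂ)) * h ξ := funext hg
    rw [this]
    exact continuous_const.mul (fourier_cont h hh)
  refine ⟨hgc, fun x z => ?_⟩
  have key : f (x, z) = c1⁻¹ * ((G : ℂ) * ∫ u in Ioi (0 : ℝ), ((u ^ (s / 2 - 1) : ℝ) : ℂ) *
      ((((4 * π * u) ^ (-(K / 2)) : ℝ) : ℂ) *
        ∫ y : ∀ j : Fin i, Fin (k j) → ℝ, ((Real.exp (-(qf (x - y) / (4 * u))) : ℝ) : ℂ) *
          grpFracLap i k m s f (y, z))) := by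
    have h1 := hinv (x, z)
    have h2 : grpFt i k m (grpFt i k m f) (-(x, z)) = (gcst i k m : ℂ) *
      ∫ ξ : GrpDom i k m, Complex.exp (Complex.I * (gpair (x, z) ξ : ℂ)) * Θ ξ := by
      rw [grpFt_eq]
      congr 1
      apply integral_congr_ae
      refine Filter.Eventually.of_forall fun ξ => ?_
      simp only
      rw [gpair_neg, hΘ]
      congr 2
      push_cast
      ring
    rw [h2, subord j l s hs] at h1
    rw [eq_inv_mul_iff_mul_eq₀ hc1, ← h1, mul_left_comm, ← integral_const_mul]
    congr 1
    apply setIntegral_congr_fun measurableSet_Ioi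
    intro u hu
    have hu' : 0 < u := hu
    simp only
    have h3 := gauss_fubini h hh u hu x z
    have h4 : ∫ y : ∀ j : Fin i, Fin (k j) → ℝ, ((Real.exp (-(qf (x - y) / (4 * u))) : ℝ) : ℂ) *
          grpFracLap i k m s f (y, z) = (gcst i k m : ℂ) *
        ∫ y : ∀ j : Fin i, Fin (k j) → ℝ, ((Real.exp (-(qf (x - y) / (4 * u))) : ℝ) : ℂ) *
      ∫ ξ : GrpDom i k m, Complex.exp (Complex.I * (gpair (y, z) ξ : ℂ)) * h ξ := by
      rw [← integral_const_mul]
      congr 1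
      funext y
      rw [hg]
      ring
    rw [h4, h3]
    have h5 : (((4 * π * u) ^ (-(K / 2)) : ℝ) : ℂ) * (((4 * π * u) ^ (K / 2) : ℝ) : ℂ) = 1 := by
      rw [← Complex.ofReal_mul, ← Real.rpow_add (by positivity), neg_add_cancel, Real.rpow_zero,
        Complex.ofReal_one]
    calc _ = ((u ^ (s / 2 - 1) : ℝ) : ℂ) * ((gcst i k m : ℂ) * (∫ ξ : GrpDom i k m, Complex.exp (Complex.I * (gpair (x, z) ξ : ℂ)) *
        (((Real.exp (-(u * qf ξ.1)) : ℝ) : ℂ) * h ξ)) * ((((4 * π * u) ^ (-(K / 2)) : ℝ) : ℂ) * (((4 * π * u) ^ (K / 2) : ℝ) : ℂ))) := by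
          rw [h5, mul_one]; exact mul_left_comm _ _ _
      _ = _ := by ring
  have hGpos : 0 < G := inv_pos.2 (Real.Gamma_pos_of_pos (by positivity))
  have hgm : Measurable (fun y : ∀ j : Fin i, Fin (k j) → ℝ => ‖grpFracLap i k m s f (y, z)‖ₑ) :=
    (hgc.comp (by fun_prop : Continuous fun y : ∀ j : Fin i, Fin (k j) → ℝ => (y, z))).measurable.enorm
  have hqm : Measurable (fun y : ∀ j : Fin i, Fin (k j) → ℝ => qf (x - y)) :=
    (continuous_qf.comp (by fun_prop : Continuous fun y : ∀ j : Fin i, Fin (k j) → ℝ => x - y)).measurable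
  rw [key, enorm_mul, enorm_mul]
  have hb : ‖∫ u in Ioi (0 : ℝ), ((u ^ (s / 2 - 1) : ℝ) : ℂ) *
      ((((4 * π * u) ^ (-(K / 2)) : ℝ) : ℂ) *
        ∫ y : ∀ j : Fin i, Fin (k j) → ℝ, ((Real.exp (-(qf (x - y) / (4 * u))) : ℝ) : ℂ) *
          grpFracLap i k m s f (y, z))‖ₑ ≤ ENNReal.ofReal ((4 * π) ^ (-(K / 2)) * (4 ^ a * Real.Gamma a)) *
          ∫⁻ y : ∀ j : Fin i, Fin (k j) → ℝ, ‖grpFracLap i k m s f (y, z)‖ₑ *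
          ENNReal.ofReal (qf (x - y)) ^ (-a) := by
    calc _ ≤ ∫⁻ u in Ioi (0 : ℝ), ‖((u ^ (s / 2 - 1) : ℝ) : ℂ) *
      ((((4 * π * u) ^ (-(K / 2)) : ℝ) : ℂ) *
        ∫ y : ∀ j : Fin i, Fin (k j) → ℝ, ((Real.exp (-(qf (x - y) / (4 * u))) : ℝ) : ℂ) *
          grpFracLap i k m s f (y, z))‖ₑ := enorm_integral_le_lintegral_enorm _
      _ ≤ ∫⁻ u in Ioi (0 : ℝ), ∫⁻ y : ∀ j : Fin i, Fin (k j) → ℝ, ENNReal.ofReal ((4 * π) ^ (-(K / 2))) *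
          (ENNReal.ofReal (u ^ (-a - 1) * Real.exp (-(qf (x - y) / (4 * u)))) *
            ‖grpFracLap i k m s f (y, z)‖ₑ) := by
        refine setLIntegral_mono' measurableSet_Ioi fun u hu => ?_
        have hu' : 0 < u := hu
        have hpre : ‖((u ^ (s / 2 - 1) : ℝ) : ℂ)‖ₑ * ‖((((4 * π * u) ^ (-(K / 2)) : ℝ)) : ℂ)‖ₑ =
          ENNReal.ofReal ((4 * π) ^ (-(K / 2)) * u ^ (-a - 1)) := by
          rw [← enorm_mul, ← Complex.ofReal_mul, ← ofReal_norm, Complex.norm_real,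
            Real.norm_of_nonneg (by positivity), Real.mul_rpow (by positivity) hu'.le, mul_left_comm,
            ← Real.rpow_add hu']
          congr 3
          rw [ha]; ring
        rw [enorm_mul, enorm_mul, ← mul_assoc, hpre]
        refine (mul_le_mul_right (enorm_integral_le_lintegral_enorm _) _).trans ?_
        rw [← lintegral_const_mul']
        · refine lintegral_mono fun y => ?_
          rw [enorm_mul]
          have : ‖((Real.exp (-(qf (x - y) / (4 * u))) : ℝ) : ℂ)‖ₑ = ENNReal.ofReal (Real.exp (-(qf (x - y) / (4 * u)))) := by
            rw [← ofReal_norm, Complex.norm_real, Real.norm_of_nonneg (by positivity)]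
          rw [this, ENNReal.ofReal_mul (by positivity), ENNReal.ofReal_mul (by positivity)]
          apply le_of_eq
          ring
        · exact ENNReal.ofReal_ne_top
      _ = ∫⁻ y : ∀ j : Fin i, Fin (k j) → ℝ, ∫⁻ u in Ioi (0 : ℝ), ENNReal.ofReal ((4 * π) ^ (-(K / 2))) *
          (ENNReal.ofReal (u ^ (-a - 1) * Real.exp (-(qf (x - y) / (4 * u)))) *
            ‖grpFracLap i k m s f (y, z)‖ₑ) := by
        apply lintegral_lintegral_swap
        apply Measurable.aemeasurable
        unfold Function.uncurry
        refine Measurable.const_mul (Measurable.mul ?_ (hgm.comp measurable_snd)) _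
        refine ENNReal.measurable_ofReal.comp (Measurable.mul (measurable_fst.pow_const _) ?_)
        exact Real.measurable_exp.comp ((hqm.comp measurable_snd).div (measurable_fst.const_mul 4)).neg
      _ = ∫⁻ y : ∀ j : Fin i, Fin (k j) → ℝ, ENNReal.ofReal ((4 * π) ^ (-(K / 2)) * (4 ^ a * Real.Gamma a)) *
          (‖grpFracLap i k m s f (y, z)‖ₑ * ENNReal.ofReal (qf (x - y)) ^ (-a)) := by
        have hne : ∀ᵐ y : ∀ j : Fin i, Fin (k j) → ℝ, y j l ≠ x j l := by
          have h0 : ∀ᵐ t : ℝ, t ≠ x j l := by simp [ae_iff]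
          have h1 : ∀ᵐ v : Fin (k j) → ℝ, v l ≠ x j l :=
            (Measure.quasiMeasurePreserving_eval (fun _ : Fin (k j) => (volume : Measure ℝ)) l).ae h0
          exact (Measure.quasiMeasurePreserving_eval (fun j : Fin i => (volume : Measure (Fin (k j) → ℝ))) j).ae h1
        apply lintegral_congr_ae
        filter_upwards [hne] with y hy
        have hq : 0 < qf (x - y) := by
          refine lt_of_lt_of_le ?_ (sq_le_qf (x - y) j l)
          have : (x - y) j l ≠ 0 := sub_ne_zero.2 hy.symm
          positivity
        have hmu : Measurable fun u : ℝ => ENNReal.ofReal (u ^ (-a - 1) * Real.exp (-(qf (x - y) / (4 * u)))) := by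
          refine ENNReal.measurable_ofReal.comp (Measurable.mul (measurable_id.pow_const _) ?_)
          exact Real.measurable_exp.comp (measurable_const.div (measurable_id.const_mul 4)).neg
        rw [lintegral_const_mul _ (hmu.mul_const _), lintegral_mul_const _ hmu, ker_int a _ ha0 hq,
          Real.div_rpow (by norm_num) hq.le, div_eq_mul_inv (4 ^ a), ← Real.rpow_neg hq.le,
          ENNReal.ofReal_mul (by positivity), ENNReal.ofReal_mul (by positivity),
          ENNReal.ofReal_mul (by positivity), ENNReal.ofReal_mul (by positivity), ENNReal.ofReal_rpow_of_pos hq]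
        ring
      _ = _ := lintegral_const_mul' _ _ ENNReal.ofReal_ne_top
  calc _ ≤ _ := mul_le_mul_right (mul_le_mul_right hb _) _
    _ = _ := by
      have e1 : ‖(G : ℂ)‖ₑ = ENNReal.ofReal G := by
        rw [← ofReal_norm, Complex.norm_real, Real.norm_of_nonneg hGpos.le]
      rw [e1, ← ofReal_norm, ← mul_assoc, ← mul_assoc, ← ENNReal.ofReal_mul (by positivity),
        ← ENNReal.ofReal_mul (by positivity)]
      congr 2
      ring


theorem enn_rpow_sum {ι : Type*} (S : Finset ι) (a : ℝ≥0∞) (c : ι → ℝ) (hc : ∀ p, 0 ≤ c p) :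
    a ^ (∑ p ∈ S, c p) = ∏ p ∈ S, a ^ c p := by
  classical
  induction S using Finset.induction_on with
  | empty => simp
  | insert p S hp ih =>
    rw [Finset.sum_insert hp, Finset.prod_insert hp, ← ih,
      ENNReal.rpow_add_of_nonneg _ _ (hc p) (Finset.sum_nonneg fun p _ => hc p)]

theorem prod_bound {ι : Type*} [Fintype ι] (q : ℝ) (d c : ι → ℝ) (hc : ∀ p, 0 ≤ c p)
    (hd : ∀ p, d p ^ 2 ≤ q) :
    ENNReal.ofReal q ^ (-((∑ p, c p) / 2)) ≤ ∏ p, ENNReal.ofReal |d p| ^ (-c p) := by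
  have h1 : ENNReal.ofReal q ^ (-((∑ p, c p) / 2)) = ∏ p, ENNReal.ofReal q ^ (-(c p / 2)) := by
    rw [ENNReal.rpow_neg, ← ENNReal.inv_rpow, Finset.sum_div,
      enn_rpow_sum _ _ _ (fun p => by have := hc p; positivity)]
    refine Finset.prod_congr rfl fun p _ => ?_
    rw [ENNReal.rpow_neg, ENNReal.inv_rpow]
  rw [h1]
  refine Finset.prod_le_prod' fun p _ => ?_
  refine (ofReal_rpow_neg_anti (hd p) (by have := hc p; positivity)).trans ?_
  rw [← sq_abs, ENNReal.ofReal_pow (abs_nonneg _), ← ENNReal.rpow_natCast, ← ENNReal.rpow_mul]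
  apply le_of_eq
  congr 1
  push_cast
  ring

/-- The one-dimensional exponents attached to each coordinate. -/
def bet {i : ℕ} (k : Fin i → ℕ) (α : Fin i → ℝ) (p : Σ j, Fin (k j)) : ℝ := α p.1 / k p.1

theorem sum_bet {i : ℕ} (k : Fin i → ℕ) (hk : ∀ j, 0 < k j) (α : Fin i → ℝ) :
    ∑ p, bet k α p = ∑ j, α j := by
  rw [Fintype.sum_sigma]
  refine Finset.sum_congr rfl fun j _ => ?_
  simp only [bet, Finset.sum_const, Finset.card_univ, Fintype.card_fin, nsmul_eq_mul]
  have : (k j : ℝ) ≠ 0 := by exact_mod_cast (hk j).ne'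
  field_simp

theorem weight_bound {i : ℕ} {k : Fin i → ℕ} (hk : ∀ j, 0 < k j) (α : Fin i → ℝ) (hα : ∀ j, 0 < α j)
    (x : ∀ j : Fin i, Fin (k j) → ℝ) (hx : ∀ j l, x j l ≠ 0) (w : ℂ) :
    (‖w / (((∏ j, (∑ l, x j l ^ 2) ^ (α j / 2) : ℝ)) : ℂ)‖₊ : ℝ≥0∞) ≤
      ‖w‖ₑ * ∏ p : (Σ j, Fin (k j)), ENNReal.ofReal |x p.1 p.2| ^ (-bet k α p) := by
  have hQ : ∀ j, 0 < ∑ l, x j l ^ 2 := fun j => by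
    have : x j ⟨0, hk j⟩ ^ 2 ≤ ∑ l, x j l ^ 2 :=
      Finset.single_le_sum (f := fun l => x j l ^ 2) (fun l _ => by positivity) (Finset.mem_univ _)
    have h2 : 0 < x j ⟨0, hk j⟩ ^ 2 := by have := hx j ⟨0, hk j⟩; positivity
    linarith
  change ‖w / (((∏ j, (∑ l, x j l ^ 2) ^ (α j / 2) : ℝ)) : ℂ)‖ₑ ≤ _
  rw [div_eq_mul_inv, enorm_mul, ← Complex.ofReal_inv, ← ofReal_norm ((( _ : ℝ)) : ℂ), Complex.norm_real,
    ← Finset.prod_inv_distrib, Real.norm_of_nonneg (Finset.prod_nonneg fun j _ => by have := hQ j; positivity),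
    ENNReal.ofReal_prod_of_nonneg (fun j _ => by have := hQ j; positivity), Fintype.prod_sigma]
  refine mul_le_mul_right (Finset.prod_le_prod' fun j _ => ?_) _
  rw [← Real.rpow_neg (hQ j).le, ← ENNReal.ofReal_rpow_of_pos (hQ j)]
  have hs : ∑ l : Fin (k j), bet k α ⟨j, l⟩ = α j := by
    simp only [bet, Finset.sum_const, Finset.card_univ, Fintype.card_fin, nsmul_eq_mul]
    have : (k j : ℝ) ≠ 0 := by exact_mod_cast (hk j).ne'
    field_simp
  have := prod_bound (∑ l, x j l ^ 2) (x j) (fun l => bet k α ⟨j, l⟩)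
    (fun l => by unfold bet; have := hα j; positivity)
    (fun l => Finset.single_le_sum (f := fun l => x j l ^ 2) (fun l _ => by positivity) (Finset.mem_univ l))
  rw [hs] at this
  exact this

theorem pt_bound {i : ℕ} {k : Fin i → ℕ} (hk : ∀ j, 0 < k j) (α : Fin i → ℝ) (hα : ∀ j, 0 < α j)
    (hα1 : ∀ j, α j < k j) (x : ∀ j : Fin i, Fin (k j) → ℝ) (hx : ∀ j l, x j l ≠ 0)
    (g : (∀ j : Fin i, Fin (k j) → ℝ) → ℝ≥0∞) (hg : Measurable g) :
    (∫⁻ y, g y * ENNReal.ofReal (qf (x - y)) ^ (-((((∑ j, k j : ℕ) : ℝ) - ∑ j, α j) / 2))) *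
      (∏ p : (Σ j, Fin (k j)), ENNReal.ofReal |x p.1 p.2| ^ (-bet k α p)) ≤
    ∫⁻ t : (Σ j, Fin (k j)) → ℝ, (∏ p, ENNReal.ofReal |1 - t p| ^ (bet k α p - 1)) *
      g (fun j l => t ⟨j, l⟩ * x j l) := by
  have hb1 : ∀ p, bet k α p < 1 := fun p => by
    have : (0 : ℝ) < k p.1 := by exact_mod_cast hk p.1
    exact (div_lt_one this).2 (hα1 p.1)
  have hsum : ((∑ j, k j : ℕ) : ℝ) - ∑ j, α j = ∑ p, (1 - bet k α p) := by
    rw [Finset.sum_sub_distrib, sum_bet k hk]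
    simp
  have hstep : ∀ y : ∀ j : Fin i, Fin (k j) → ℝ,
      ENNReal.ofReal (qf (x - y)) ^ (-((((∑ j, k j : ℕ) : ℝ) - ∑ j, α j) / 2)) ≤
      ∏ p : (Σ j, Fin (k j)), ENNReal.ofReal |x p.1 p.2 - y p.1 p.2| ^ (bet k α p - 1) := by
    intro y
    rw [hsum]
    refine (prod_bound _ (fun p : (Σ j, Fin (k j)) => x p.1 p.2 - y p.1 p.2) _
      (fun p => by have := hb1 p; linarith) (fun p => sq_le_qf (x - y) p.1 p.2)).trans ?_
    simp only [neg_sub, le_refl]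
  have hkm : Measurable fun y : ∀ j : Fin i, Fin (k j) → ℝ =>
      ∏ p : (Σ j, Fin (k j)), ENNReal.ofReal |x p.1 p.2 - y p.1 p.2| ^ (bet k α p - 1) := by
    refine Finset.measurable_prod _ fun p _ => Measurable.pow_const ?_ _
    refine ENNReal.measurable_ofReal.comp ?_
    have : Measurable fun y : ∀ j : Fin i, Fin (k j) → ℝ => y p.1 p.2 :=
      (measurable_pi_apply p.2).comp (measurable_pi_apply p.1)
    exact (measurable_const.sub this).abs
  have hΦ := hg.mul hkm
  have e1 : ∫⁻ y, g y * ∏ p : (Σ j, Fin (k j)), ENNReal.ofReal |x p.1 p.2 - y p.1 p.2| ^ (bet k α p - 1)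
      = (∏ p : (Σ j, Fin (k j)), ENNReal.ofReal |x p.1 p.2|) * ∫⁻ t : (Σ j, Fin (k j)) → ℝ,
        g (fun j l => x j l * t ⟨j, l⟩) * ∏ p : (Σ j, Fin (k j)),
          ENNReal.ofReal |x p.1 p.2 - x p.1 p.2 * t p| ^ (bet k α p - 1) := by
    have := (curryE_mp i k).lintegral_comp hΦ
    simp only [Pi.mul_apply] at this
    rw [← this]
    exact lintegral_diag (fun p : (Σ j, Fin (k j)) => x p.1 p.2) (fun p => hx p.1 p.2) _
      (hΦ.comp (curryE i k).measurable)
  calc _ ≤ (∫⁻ y, g y * ∏ p : (Σ j, Fin (k j)), ENNReal.ofReal |x p.1 p.2 - y p.1 p.2| ^ (bet k α p - 1)) *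
      (∏ p : (Σ j, Fin (k j)), ENNReal.ofReal |x p.1 p.2| ^ (-bet k α p)) := by
        refine mul_le_mul_left (lintegral_mono fun y => ?_) _
        exact mul_le_mul_right (hstep y) _
    _ = ((∏ p : (Σ j, Fin (k j)), ENNReal.ofReal |x p.1 p.2|) *
        (∏ p : (Σ j, Fin (k j)), ENNReal.ofReal |x p.1 p.2| ^ (-bet k α p))) *
          ∫⁻ t : (Σ j, Fin (k j)) → ℝ,
        g (fun j l => x j l * t ⟨j, l⟩) * ∏ p : (Σ j, Fin (k j)),
          ENNReal.ofReal |x p.1 p.2 - x p.1 p.2 * t p| ^ (bet k α p - 1) := by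
        rw [e1]; ring
    _ = ∫⁻ t : (Σ j, Fin (k j)) → ℝ, ((∏ p : (Σ j, Fin (k j)), ENNReal.ofReal |x p.1 p.2|) *
        (∏ p : (Σ j, Fin (k j)), ENNReal.ofReal |x p.1 p.2| ^ (-bet k α p))) *
        (g (fun j l => x j l * t ⟨j, l⟩) * ∏ p : (Σ j, Fin (k j)),
          ENNReal.ofReal |x p.1 p.2 - x p.1 p.2 * t p| ^ (bet k α p - 1)) := by
        rw [lintegral_const_mul']
        refine ENNReal.mul_ne_top (ENNReal.prod_ne_top fun p _ => ENNReal.ofReal_ne_top)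
          (ENNReal.prod_ne_top fun p _ => ?_)
        exact ENNReal.rpow_ne_top_of_ne_zero (by simp [hx p.1 p.2]) ENNReal.ofReal_ne_top
    _ ≤ _ := by
        refine lintegral_mono_ae ?_
        filter_upwards [ae_coord_ne (ι := Σ j, Fin (k j)) 1] with t ht
        have e2 : ∀ p : (Σ j, Fin (k j)), ENNReal.ofReal |x p.1 p.2| * ENNReal.ofReal |x p.1 p.2| ^ (-bet k α p) *
            ENNReal.ofReal |x p.1 p.2 - x p.1 p.2 * t p| ^ (bet k α p - 1) =
            ENNReal.ofReal |1 - t p| ^ (bet k α p - 1) := by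
          intro p
          have h0 : ENNReal.ofReal |x p.1 p.2| ≠ 0 := by simp [hx p.1 p.2]
          have h1 : ENNReal.ofReal |1 - t p| ≠ 0 := by
            have : 1 - t p ≠ 0 := sub_ne_zero.2 (ht p).symm
            simp [this]
          have h2 : x p.1 p.2 - x p.1 p.2 * t p = x p.1 p.2 * (1 - t p) := by ring
          rw [h2, abs_mul, ENNReal.ofReal_mul (abs_nonneg _), ENNReal.mul_rpow_of_ne_zero h0 h1, ← mul_assoc]
          conv_lhs => 
            rw [← ENNReal.rpow_one (ENNReal.ofReal |x p.1 p.2|)]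
          simp only [← ENNReal.rpow_mul]
          rw [← ENNReal.rpow_add _ _ h0 ENNReal.ofReal_ne_top, ← ENNReal.rpow_add _ _ h0 ENNReal.ofReal_ne_top]
          have : 1 + 1 * -bet k α p + 1 * (bet k α p - 1) = 0 := by ring
          rw [this, ENNReal.rpow_zero, one_mul]
        rw [← Finset.prod_congr rfl (fun p _ => e2 p), Finset.prod_mul_distrib, Finset.prod_mul_distrib]
        apply le_of_eq
        simp only [mul_comm (t _) _]
        ring

theorem ker_fin {i : ℕ} {k : Fin i → ℕ} (hk : ∀ j, 0 < k j)
    (P : (j : Fin i) → Fin (k j) → ℝ) (hP : ∀ j l, 1 < P j l)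
    (α : Fin i → ℝ) (hα : ∀ j, 0 < α j) (hα' : ∀ j l, α j < k j / P j l) :
    ∫⁻ t : (Σ j, Fin (k j)) → ℝ, ∏ p : (Σ j, Fin (k j)),
    (ENNReal.ofReal |1 - t p| ^ (bet k α p - 1) * ENNReal.ofReal |t p| ^ (-(P p.1 p.2)⁻¹)) < ∞ := by
  refine lint_prod_lt_top (ι := Σ j, Fin (k j)) (fun p t => ENNReal.ofReal |1 - t| ^ (bet k α p - 1) *
      ENNReal.ofReal |t| ^ (-(P p.1 p.2)⁻¹)) (fun p => ?_) (fun p => ?_)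
  · refine Measurable.mul (Measurable.pow_const ?_ _) (Measurable.pow_const ?_ _)
    · exact ENNReal.measurable_ofReal.comp (measurable_const.sub measurable_id).abs
    · exact ENNReal.measurable_ofReal.comp measurable_id.abs
  · have hkp : (0 : ℝ) < k p.1 := by exact_mod_cast hk p.1
    have hPp : 0 < P p.1 p.2 := by linarith [hP p.1 p.2]
    refine lint_kernel _ _ (div_pos (hα p.1) hkp) ?_ (inv_lt_one_of_one_lt₀ (hP p.1 p.2))
    unfold bet
    rw [div_lt_iff₀ hkp]
    have := hα' p.1 p.2
    rw [div_eq_mul_inv, mul_comm] at this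
    exact this

theorem ker_meas {ι : Type} [Fintype ι] (b : ι → ℝ) :
    Measurable fun t : ι → ℝ => ∏ p, ENNReal.ofReal |1 - t p| ^ (b p) := by
  refine Finset.measurable_prod _ fun p _ => Measurable.pow_const ?_ _
  exact ENNReal.measurable_ofReal.comp (measurable_const.sub (measurable_pi_apply p)).abs

theorem ker_meas2 {ι : Type} [Fintype ι] (b c : ι → ℝ) :
    Measurable fun t : ι → ℝ => ∏ p, (ENNReal.ofReal |1 - t p| ^ (b p) * ENNReal.ofReal |t p| ^ (c p)) := by
  refine Finset.measurable_prod _ fun p _ => Measurable.mul (Measurable.pow_const ?_ _) (Measurable.pow_const ?_ _)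
  · exact ENNReal.measurable_ofReal.comp (measurable_const.sub (measurable_pi_apply p)).abs
  · exact ENNReal.measurable_ofReal.comp (measurable_pi_apply p).abs

theorem dil_meas {i : ℕ} {k : Fin i → ℕ} (g : (∀ j : Fin i, Fin (k j) → ℝ) → ℝ≥0∞) (hgm : Measurable g) :
    Measurable (Function.uncurry fun (t : (Σ j, Fin (k j)) → ℝ) (x : ∀ j : Fin i, Fin (k j) → ℝ) =>
      g (fun j l => t ⟨j, l⟩ * x j l)) := by
  refine hgm.comp ?_
  refine measurable_pi_lambda _ fun j => measurable_pi_lambda _ fun l => ?_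
  refine Measurable.mul ((measurable_pi_apply _).comp measurable_fst) ?_
  exact (measurable_pi_apply l).comp ((measurable_pi_apply j).comp measurable_snd)

theorem abs_bound {T X : Type} [MeasureSpace T] [SFinite (volume : Measure T)] [MeasurableSpace X]
    {S : Set X} {N : (X → ℝ≥0∞) → ℝ≥0∞}
    (hN : NiceN S N) (A : ℝ≥0∞) 
    (hmink : ∀ (T : Type) [MeasurableSpace T] (m : Measure T) [SFinite m]
      (F : T → X → ℝ≥0∞), Measurable (Function.uncurry F) →
      N (fun x => ∫⁻ t, F t x ∂m) ≤ A * ∫⁻ t, N (F t) ∂m)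
    (F : T → X → ℝ≥0∞) (hF : Measurable (Function.uncurry F)) (ρ : T → ℝ≥0∞) (hρ : Measurable ρ)
    (h : X → ℝ≥0∞) (hh : ∀ x ∈ S, h x ≤ ∫⁻ t, ρ t * F t x)
    (w : T → ℝ≥0∞) (Ng : ℝ≥0∞) (hw : ∀ᵐ t, ρ t * N (F t) ≤ w t * Ng) (hwm : Measurable w) :
    N h ≤ A * ((∫⁻ t, w t) * Ng) := by
  have h1 := hN.mono h (fun x => ∫⁻ t, F t x ∂(volume.withDensity ρ)) fun x hx => by
    refine (hh x hx).trans (le_of_eq ?_)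
    have hFx : Measurable fun t => F t x := hF.comp (measurable_id.prodMk measurable_const)
    rw [lintegral_withDensity_eq_lintegral_mul _ hρ hFx]
    rfl
  refine h1.trans ((hmink _ _ F hF).trans (mul_le_mul_right ?_ _))
  rw [lintegral_withDensity_eq_lintegral_mul _ hρ (hN.meas _ F hF), ← lintegral_mul_const _ hwm]
  exact lintegral_mono_ae hw

theorem core_bound {i : ℕ} {k : Fin i → ℕ} (hk : ∀ j, 0 < k j)
    (P : (j : Fin i) → Fin (k j) → ℝ) (Q : (j : Fin i) → Fin (k j) → ℝ≥0∞)
    (hP : ∀ j l, 1 < P j l) (hQ : ∀ j l, 1 ≤ Q j l)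
    (α : Fin i → ℝ) (hα : ∀ j, 0 < α j) (hα1 : ∀ j, α j < k j)
    (A : ℝ≥0∞) (N : ((∀ j : Fin i, Fin (k j) → ℝ) → ℝ≥0∞) → ℝ≥0∞)
    (hN : NiceN {x : ∀ j : Fin i, Fin (k j) → ℝ | ∀ j l, x j l ≠ 0} N)
    (hNe : N = grpNorm i k (fun j l => ENNReal.ofReal (P j l)) Q)
    (hmink : ∀ (T : Type) [MeasurableSpace T] (m : Measure T) [SFinite m]
      (F : T → (∀ j : Fin i, Fin (k j) → ℝ) → ℝ≥0∞), Measurable (Function.uncurry F) →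
      N (fun x => ∫⁻ t, F t x ∂m) ≤ A * ∫⁻ t, N (F t) ∂m) (C : ℝ≥0∞) (hC : C ≠ ∞)
    (f : (∀ j : Fin i, Fin (k j) → ℝ) → ℂ) (g : (∀ j : Fin i, Fin (k j) → ℝ) → ℝ≥0∞) (hgm : Measurable g)
    (hpt : ∀ x, ‖f x‖ₑ ≤ C * ∫⁻ y : ∀ j : Fin i, Fin (k j) → ℝ, g y *
          ENNReal.ofReal (qf (x - y)) ^ (-((((∑ j, k j : ℕ) : ℝ) - ∑ j, α j) / 2))) :
    N (fun x => (‖f x / (((∏ j, (∑ l, x j l ^ 2) ^ (α j / 2) : ℝ)) : ℂ)‖₊ : ℝ≥0∞))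
      ≤ A * ((∫⁻ t : (Σ j, Fin (k j)) → ℝ, C * ∏ p : (Σ j, Fin (k j)),
    (ENNReal.ofReal |1 - t p| ^ (bet k α p - 1) * ENNReal.ofReal |t p| ^ (-(P p.1 p.2)⁻¹))) * N g) := by
  have hm1 := ker_meas (fun p => bet k α p - 1)
  have hm2 := ker_meas2 (fun p => bet k α p - 1) (fun p : (Σ j, Fin (k j)) => -(P p.1 p.2)⁻¹)
  refine abs_bound (T := (Σ j, Fin (k j)) → ℝ) hN A hmink _ (dil_meas g hgm)
    (fun t => C * ∏ p, ENNReal.ofReal |1 - t p| ^ (bet k α p - 1)) (hm1.const_mul C) _ ?_ _ _ ?_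
    (hm2.const_mul C)
  · intro x hx
    refine (weight_bound hk α hα x hx _).trans ?_
    refine (mul_le_mul_left (hpt x) _).trans ?_
    rw [mul_assoc]
    refine (mul_le_mul_right (pt_bound hk α hα hα1 x hx g hgm) _).trans ?_
    rw [← lintegral_const_mul' _ _ hC]
    refine le_of_eq (lintegral_congr fun t => ?_)
    rw [mul_assoc]
  · filter_upwards [ae_coord_ne (ι := Σ j, Fin (k j)) 0] with t ht
    have hd := dil_grp i k P hP Q hQ (fun j l => t ⟨j, l⟩) (fun j l => ht _) g
    rw [← hNe] at hd
    refine (mul_le_mul_right hd _).trans (le_of_eq ?_)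
    have e : (∏ j, ∏ l, ENNReal.ofReal |t ⟨j, l⟩| ^ (-(P j l)⁻¹)) =
        ∏ p : (Σ j, Fin (k j)), ENNReal.ofReal |t p| ^ (-(P p.1 p.2)⁻¹) :=
      (Fintype.prod_sigma (fun p : (Σ j, Fin (k j)) => ENNReal.ofReal |t p| ^ (-(P p.1 p.2)⁻¹))).symm
    rw [Finset.prod_mul_distrib, e]
    simp only [mul_assoc]

theorem grp_bound (i : ℕ) (k : Fin i → ℕ) (hk : ∀ j, 0 < k j) (m : ℕ) (hi : 0 < i)
    (P : (j : Fin i) → Fin (k j) → ℝ) (Q : (j : Fin i) → Fin (k j) → ℝ≥0∞)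
    (hP : ∀ j l, 1 < P j l) (hQ : ∀ j l, 1 ≤ Q j l)
    (α : Fin i → ℝ) (hα : ∀ j, 0 < α j) (hα' : ∀ j l, α j < k j / P j l) :
    ∃ C : ℝ≥0∞, C ≠ ∞ ∧ ∀ f : GrpDom i k m → ℂ,
      ContDiff ℝ (⊤ : ℕ∞) f → HasCompactSupport f → ∀ z : Fin m → ℝ,
      grpNorm i k (fun j l => ENNReal.ofReal (P j l)) Q
          (fun x => (‖f (x, z) / (((∏ j, (∑ l, x j l ^ 2) ^ (α j / 2) : ℝ)) : ℂ)‖₊ : ℝ≥0∞))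
        ≤ C * grpNorm i k (fun j l => ENNReal.ofReal (P j l)) Q
            (fun x => (‖grpFracLap i k m (∑ j, α j) f (x, z)‖₊ : ℝ≥0∞)) := by
  have hN := nice_grp i k P hP Q hQ
  obtain ⟨A, hA, hmink⟩ := hN.mink
  have hα1 : ∀ j, α j < k j := fun j => by
    refine (hα' j ⟨0, hk j⟩).trans_le (div_le_self (Nat.cast_nonneg _) (hP _ _).le)
  have hne : (Finset.univ : Finset (Fin i)).Nonempty := ⟨⟨0, hi⟩, Finset.mem_univ _⟩
  have hs0 : 0 < ∑ j, α j := Finset.sum_pos (fun j _ => hα j) hne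
  have hsK : ∑ j, α j < ((∑ j, k j : ℕ) : ℝ) := by
    push_cast
    exact Finset.sum_lt_sum_of_nonempty hne fun j _ => hα1 j
  obtain ⟨C, hC, hR⟩ := riesz_pt i k m ⟨0, hi⟩ ⟨0, hk _⟩ _ hs0 hsK
  have hIfin := ker_fin hk P hP α hα hα'
  have hm2 := ker_meas2 (fun p => bet k α p - 1) (fun p : (Σ j, Fin (k j)) => -(P p.1 p.2)⁻¹)
  refine ⟨A * (C * ∫⁻ t : (Σ j, Fin (k j)) → ℝ, ∏ p : (Σ j, Fin (k j)),
    (ENNReal.ofReal |1 - t p| ^ (bet k α p - 1) * ENNReal.ofReal |t p| ^ (-(P p.1 p.2)⁻¹))),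
    ENNReal.mul_ne_top hA (ENNReal.mul_ne_top hC hIfin.ne), ?_⟩
  intro f hf hsupp z
  obtain ⟨hgc, hpt⟩ := hR f hf hsupp
  have hgm : Measurable fun x : ∀ j : Fin i, Fin (k j) → ℝ =>
      ‖grpFracLap i k m (∑ j, α j) f (x, z)‖ₑ :=
    (hgc.comp (by fun_prop : Continuous fun y : ∀ j : Fin i, Fin (k j) → ℝ => (y, z))).measurable.enorm
  have hpt' := fun x => hpt x z
  have h := core_bound hk P Q hP hQ α hα hα1 A _ hN rfl hmink C hC (fun x => f (x, z)) _ hgm hpt'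
  rw [lintegral_const_mul' _ _ hC, ← mul_assoc] at h
  exact h

theorem case_zero (k : Fin 0 → ℕ) (m : ℕ)
    (P Q : (j : Fin 0) → Fin (k j) → ℝ≥0∞) (α : Fin 0 → ℝ) :
    ∃ C : ℝ≥0∞, C ≠ ∞ ∧ ∀ f : GrpDom 0 k m → ℂ,
      ContDiff ℝ (⊤ : ℕ∞) f → HasCompactSupport f → ∀ z : Fin m → ℝ,
      grpNorm 0 k P Q
          (fun x => (‖f (x, z) / (((∏ j, (∑ l, x j l ^ 2) ^ (α j / 2) : ℝ)) : ℂ)‖₊ : ℝ≥0∞))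
        ≤ C * grpNorm 0 k P Q
            (fun x => (‖grpFracLap 0 k m (∑ j, α j) f (x, z)‖₊ : ℝ≥0∞)) := by
  obtain ⟨c1, hc1, hF⟩ := fourier_facts 0 k m
  refine ⟨‖c1⁻¹‖ₑ, enorm_ne_top, fun f hf hs z => ?_⟩
  have h := (hF f hf hs).2
  have e : ∀ x, grpFracLap 0 k m (∑ j, α j) f x = c1 * f x := by
    intro x
    rw [← h]
    unfold grpFracLap
    simp
  simp only [e, grpNorm]
  simp only [Finset.univ_eq_empty, Finset.prod_empty, Complex.ofReal_one, div_one]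
  change ‖(_ : ℂ)‖ₑ ≤ ‖(_ : ℂ)‖ₑ * ‖(_ : ℂ)‖ₑ
  rw [← enorm_mul, inv_mul_cancel_left₀ hc1]

/-- **Corollary 1.3: anisotropic Hardy–Sobolev inequality in iterated mixed Lorentz
spaces.** On `ℝⁿ = ℝ^{k_1} × ⋯ × ℝ^{k_i} × ℝ^{n−Σk_j}`, with `r_j` the Euclidean norm of
the `j`-th group of coordinates, `0 < p,q ≤ ∞`, `1 < (p⃗_j)_ℓ < ∞`, `1 ≤ (q⃗_j)_ℓ ≤ ∞`
and `0 < α_j < k_j/(p⃗_j)_ℓ`, one has, for all `f ∈ C_0^∞`,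
`‖ f / ∏_j r_j^{α_j} ‖ ≤ C ‖ Λ^{Σα_j}_{(first Σk_j coords)} f ‖` in the iterated norm
`L^{p⃗_1,q⃗_1}(ℝ^{k_1}) ⋯ L^{p⃗_i,q⃗_i}(ℝ^{k_i}) L^{p,q}(ℝ^{n−Σk_j})`. -/
theorem anisotropic_hardy_sobolev_grouped_mixed_lorentz
    (i : ℕ) (k : Fin i → ℕ) (hk : ∀ j, 0 < k j) (m : ℕ)
    (P : (j : Fin i) → Fin (k j) → ℝ) (Q : (j : Fin i) → Fin (k j) → ℝ≥0∞)
    (hP : ∀ j ℓ, 1 < P j ℓ) (hQ : ∀ j ℓ, 1 ≤ Q j ℓ)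
    (p q : ℝ≥0∞) (hp : 0 < p) (hq : 0 < q)
    (α : Fin i → ℝ) (hα : ∀ j, 0 < α j) (hα' : ∀ j ℓ, α j < k j / P j ℓ) :
    ∃ C : ℝ, 0 < C ∧ ∀ f : GrpDom i k m → ℂ,
      ContDiff ℝ (⊤ : ℕ∞) f → HasCompactSupport f →
      grpFullNorm i k m (fun j ℓ => ENNReal.ofReal (P j ℓ)) Q p q
          (fun x => (‖f x / (((∏ j, (∑ ℓ, x.1 j ℓ ^ 2) ^ (α j / 2) : ℝ)) : ℂ)‖₊ : ℝ≥0∞))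
        ≤ ENNReal.ofReal C *
          grpFullNorm i k m (fun j ℓ => ENNReal.ofReal (P j ℓ)) Q p q
            (fun x => (‖grpFracLap i k m (∑ j, α j) f x‖₊ : ℝ≥0∞)) := by

  obtain ⟨C, hC, hb⟩ : ∃ C : ℝ≥0∞, C ≠ ∞ ∧ ∀ f : GrpDom i k m → ℂ,
      ContDiff ℝ (⊤ : ℕ∞) f → HasCompactSupport f → ∀ z : Fin m → ℝ,
      grpNorm i k (fun j l => ENNReal.ofReal (P j l)) Q
          (fun x => (‖f (x, z) / (((∏ j, (∑ l, x j l ^ 2) ^ (α j / 2) : ℝ)) : ℂ)‖₊ : ℝ≥0∞))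
        ≤ C * grpNorm i k (fun j l => ENNReal.ofReal (P j l)) Q
            (fun x => (‖grpFracLap i k m (∑ j, α j) f (x, z)‖₊ : ℝ≥0∞)) := by
    rcases Nat.eq_zero_or_pos i with h0 | hi
    · subst h0
      exact case_zero k m _ _ α
    · exact grp_bound i k hk m hi P Q hP hQ α hα hα'
  refine ⟨C.toReal + 1, by positivity, fun f hf hs => ?_⟩
  have hCle : C ≤ ENNReal.ofReal (C.toReal + 1) := by
    rw [← ENNReal.ofReal_toReal hC]
    exact ENNReal.ofReal_le_ofReal (by simp)
  unfold grpFullNorm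
  refine le_trans (lorentz_mono_ae p q (Filter.Eventually.of_forall fun z =>
    (hb f hf hs z).trans (mul_le_mul_left hCle _))) ?_
  refine lorentz_const_mul p q hq _ _ ?_ ENNReal.ofReal_ne_top
  have : 0 < C.toReal + 1 := by positivity
  simpa using this
end
end
end

section
/- Let 0 < α < 1/4 and p > 3/(1−α) with p < ∞, and write exponents θ = (3+pα)/p ∈ (0,1). Then there exists a constant C>0 such that for all f ∈ C_0^∞(ℝ³), ‖ f / |x_3|^{α} ‖_{L^{2p/(p−2)}(ℝ³)} ≤ C ‖ f ‖_{L^2(ℝ³)}^{(p−3−pα)/p} ‖ ∇f ‖_{L^2(ℝ³)}^{(3+pα)/p}. -/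
open MeasureTheory ENNReal Real

lemma weight_int (β R : ℝ) (h1 : β < 1) (hR : 0 < R) :
    ∫⁻ t in Set.Icc (-R) R, ENNReal.ofReal (|t| ^ (-β)) ≤
      ENNReal.ofReal (2 / (1 - β) * R ^ (1 - β)) := by
  have hpos : ∫⁻ t in Set.Ioc 0 R, ENNReal.ofReal (|t| ^ (-β)) =
      ENNReal.ofReal (1 / (1 - β) * R ^ (1 - β)) := by
    have hi := intervalIntegral.intervalIntegrable_rpow' (a := 0) (b := R) (r := -β) (by linarith)
    rw [intervalIntegrable_iff, Set.uIoc_of_le hR.le] at hi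
    have := integral_rpow (a := 0) (b := R) (r := -β) (Or.inl (by linarith))
    rw [intervalIntegral.integral_of_le hR.le, Real.zero_rpow (by linarith)] at this
    have h2 := ofReal_integral_eq_lintegral_ofReal hi
      ((ae_restrict_iff' measurableSet_Ioc).2 (Filter.Eventually.of_forall
        fun t ht => Real.rpow_nonneg ht.1.le _))
    rw [this] at h2
    rw [show 1 / (1 - β) * R ^ (1 - β) = (R ^ (-β + 1) - 0) / (-β + 1) by
      rw [show -β + 1 = 1 - β by ring]; ring, h2]
    refine setLIntegral_congr_fun measurableSet_Ioc fun t ht => ?_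
    simp only [abs_of_pos ht.1]
  have hneg : ∫⁻ t in Set.Ico (-R) 0, ENNReal.ofReal (|t| ^ (-β)) =
      ENNReal.ofReal (1 / (1 - β) * R ^ (1 - β)) := by
    rw [← hpos]
    have := (Measure.measurePreserving_neg (volume : Measure ℝ)).setLIntegral_comp_preimage_emb
      (MeasurableEquiv.neg ℝ).measurableEmbedding
      (fun t => ENNReal.ofReal (|t| ^ (-β))) (Set.Ioc 0 R)
    rw [← this]
    simp
  have hsub : Set.Icc (-R) R ⊆ (Set.Ico (-R) 0 ∪ Set.Ioc 0 R) ∪ {0} := by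
    intro t ht
    rcases lt_trichotomy t 0 with h | h | h
    · exact Or.inl (Or.inl ⟨ht.1, h⟩)
    · exact Or.inr h
    · exact Or.inl (Or.inr ⟨h, ht.2⟩)
  have hc : 0 ≤ 1 / (1 - β) * R ^ (1 - β) :=
    mul_nonneg (one_div_nonneg.2 (by linarith)) (Real.rpow_nonneg hR.le _)
  calc _ ≤ _ := lintegral_mono_set hsub
    _ ≤ _ := lintegral_union_le _ _ _
    _ ≤ _ := add_le_add (lintegral_union_le _ _ _) le_rfl
    _ = _ := by
      rw [hpos, hneg, ← ENNReal.ofReal_add hc hc]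
      simp only [Measure.restrict_singleton, Real.volume_singleton, zero_smul, lintegral_zero_measure, add_zero]
      congr 1; ring

lemma one_dim (β R : ℝ) (h0 : 0 ≤ β) (h1 : β < 1) (hR : 0 < R) (w : ℝ → ℝ≥0∞) (M : ℝ≥0∞)
    (hw : Measurable w) (hM : ∀ t, w t ≤ M) :
    ∫⁻ t, w t * ENNReal.ofReal (|t| ^ (-β)) ≤
      ENNReal.ofReal (2 / (1 - β) * R ^ (1 - β)) * M + ENNReal.ofReal (R ^ (-β)) * ∫⁻ t, w t := by
  rw [← lintegral_add_compl _ (measurableSet_Icc (a := -R) (b := R))]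
  refine add_le_add ?_ ?_
  · calc _ ≤ ∫⁻ t in Set.Icc (-R) R, M * ENNReal.ofReal (|t| ^ (-β)) :=
          lintegral_mono fun t => by gcongr; exact hM t
      _ = M * ∫⁻ t in Set.Icc (-R) R, ENNReal.ofReal (|t| ^ (-β)) :=
          lintegral_const_mul _ (by fun_prop)
      _ ≤ M * _ := by gcongr; exact weight_int β R h1 hR
      _ = _ := mul_comm _ _
  · calc _ ≤ ∫⁻ t in (Set.Icc (-R) R)ᶜ, ENNReal.ofReal (R ^ (-β)) * w t := by
          refine setLIntegral_mono (by fun_prop) fun t ht => ?_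
          rw [mul_comm]
          have : R < |t| := by
            by_contra hh
            exact ht (abs_le.1 (not_lt.1 hh))
          exact mul_le_mul' (ENNReal.ofReal_le_ofReal
            (Real.rpow_le_rpow_of_nonpos hR this.le (by linarith))) le_rfl
      _ ≤ ∫⁻ t, ENNReal.ofReal (R ^ (-β)) * w t := setLIntegral_le_lintegral _ _
      _ = _ := lintegral_const_mul _ hw

lemma three_dim (β R : ℝ) (h0 : 0 ≤ β) (h1 : β < 1) (hR : 0 < R) (F : (Fin 3 → ℝ) → ℝ)
    (hF : ContDiff ℝ 1 F) (hc : HasCompactSupport F) :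
    ∫⁻ x, ‖F x‖ₑ * ENNReal.ofReal (|x 2| ^ (-β)) ≤
      ENNReal.ofReal (2 / (1 - β) * R ^ (1 - β)) * (∫⁻ x, ‖fderiv ℝ F x‖ₑ) +
        ENNReal.ofReal (R ^ (-β)) * ∫⁻ x, ‖F x‖ₑ := by
  have hFm : Measurable (fun x => ‖F x‖ₑ) := hF.continuous.enorm.measurable
  have hdm : Measurable (fun x => ‖fderiv ℝ F x‖ₑ) :=
    (hF.continuous_fderiv one_ne_zero).enorm.measurable
  have hwm : Measurable (fun x : Fin 3 → ℝ => ENNReal.ofReal (|x 2| ^ (-β))) := by fun_prop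
  rw [← lintegral_const_mul _ hdm, ← lintegral_const_mul _ hFm,
    ← lintegral_add_left (hdm.const_mul _)]
  refine lintegral_le_of_lmarginal_le (μ := fun _ : Fin 3 => (volume : Measure ℝ)) {2}
    (hFm.mul hwm) ((hdm.const_mul _).add (hFm.const_mul _)) ?_
  rw [lmarginal_singleton, lmarginal_singleton]
  intro x
  have hu : Measurable (fun t : ℝ => Function.update x 2 t) := measurable_update x
  have hFu := hFm.comp hu
  have hdu := hdm.comp hu
  simp only [Function.comp_def] at hFu hdu
  dsimp only
  rw [lintegral_add_left (hdu.const_mul _), lintegral_const_mul _ hdu, lintegral_const_mul _ hFu]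
  simp only [Function.update_self]
  refine one_dim β R h0 h1 hR _ _ hFu fun t => ?_
  calc ‖F (Function.update x 2 t)‖ₑ
      ≤ ∫⁻ s in Set.Iic t, ‖deriv (F ∘ Function.update x 2) s‖ₑ := by
        apply le_trans (by simp) (HasCompactSupport.enorm_le_lintegral_Ici_deriv _ _ _)
        · exact hF.comp (by convert! contDiff_update 1 x 2)
        · exact hc.comp_isClosedEmbedding (isClosedEmbedding_update x 2)
    _ ≤ ∫⁻ s, ‖fderiv ℝ F (Function.update x 2 s)‖ₑ := ?_
  gcongr with y
  · exact Measure.restrict_le_self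
  calc ‖deriv (F ∘ Function.update x 2) y‖ₑ
      = ‖fderiv ℝ F (Function.update x 2 y) (deriv (Function.update x 2) y)‖ₑ := by
        rw [fderiv_comp_deriv _ (hF.differentiable one_ne_zero).differentiableAt
          (hasDerivAt_update x 2 y).differentiableAt]
    _ ≤ ‖fderiv ℝ F (Function.update x 2 y)‖ₑ * ‖deriv (Function.update x 2) y‖ₑ :=
        ContinuousLinearMap.le_opENorm _ _
    _ ≤ ‖fderiv ℝ F (Function.update x 2 y)‖ₑ := by
        rw [(hasDerivAt_update x 2 y).deriv, Pi.enorm_single]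
        simp

lemma cs (u v : (Fin 3 → ℝ) → ℝ≥0∞) (hu : Measurable u) (hv : Measurable v) :
    ∫⁻ x, u x * v x ≤ (∫⁻ x, u x ^ 2) ^ (1 / 2 : ℝ) * (∫⁻ x, v x ^ 2) ^ (1 / 2 : ℝ) := by
  have := ENNReal.lintegral_mul_le_Lp_mul_Lq volume (p := 2) (q := 2)
    Real.HolderConjugate.two_two hu.aemeasurable hv.aemeasurable
  simpa using this

/-- weighted bound for the power `n+1` -/
lemma weighted (β : ℝ) (h0 : 0 ≤ β) (h1 : β < 1) (n : ℕ) (f : (Fin 3 → ℝ) → ℝ)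
    (hf : ContDiff ℝ 1 f) (hc : HasCompactSupport f) (a b : ℝ) (ha : 0 < a) (hb : 0 < b)
    (hN : (∫⁻ x, ‖f x‖ₑ ^ 2) ^ (1 / 2 : ℝ) = ENNReal.ofReal a)
    (hD : (∫⁻ x, ‖fderiv ℝ f x‖ₑ ^ 2) ^ (1 / 2 : ℝ) = ENNReal.ofReal b) :
    ∫⁻ x, ‖f x‖ₑ ^ (n + 1) * ENNReal.ofReal (|x 2| ^ (-β)) ≤
      ENNReal.ofReal ((2 / (1 - β) * (n + 1) + 1) * (a ^ (1 - β) * b ^ β)) *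
        (∫⁻ x, (‖f x‖ₑ ^ n) ^ 2) ^ (1 / 2 : ℝ) := by
  have hfm : Measurable (fun x => ‖f x‖ₑ) := hf.continuous.enorm.measurable
  have hdm : Measurable (fun x => ‖fderiv ℝ f x‖ₑ) :=
    (hf.continuous_fderiv one_ne_zero).enorm.measurable
  have hcF : HasCompactSupport (fun x => f x ^ (n + 1)) :=
    hc.comp_left (g := fun y => y ^ (n + 1)) (by simp)
  have key := three_dim β (a / b) h0 h1 (div_pos ha hb) (fun x => f x ^ (n + 1)) (hf.pow _) hcF
  simp only [enorm_pow] at key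
  refine key.trans ?_
  have e1 : ∫⁻ x, ‖fderiv ℝ (fun x => f x ^ (n + 1)) x‖ₑ ≤
      ENNReal.ofReal ((n + 1) * b) * (∫⁻ x, (‖f x‖ₑ ^ n) ^ 2) ^ (1 / 2 : ℝ) := by
    have : ∀ x, ‖fderiv ℝ (fun x => f x ^ (n + 1)) x‖ₑ =
        ENNReal.ofReal (n + 1) * (‖f x‖ₑ ^ n * ‖fderiv ℝ f x‖ₑ) := by
      intro x
      rw [fderiv_fun_pow _ (hf.differentiable one_ne_zero).differentiableAt]
      rw [enorm_smul]
      simp only [nsmul_eq_mul, Nat.add_sub_cancel, enorm_mul, enorm_pow]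
      rw [Real.enorm_of_nonneg (by positivity)]
      push_cast
      ring
    simp_rw [this]
    have hm : Measurable (fun x => ‖f x‖ₑ ^ n * ‖fderiv ℝ f x‖ₑ) := (hfm.pow_const n).mul hdm
    rw [lintegral_const_mul _ hm, ENNReal.ofReal_mul (by positivity),
      ← hD, mul_assoc]
    refine mul_le_mul' le_rfl ((cs _ _ (hfm.pow_const n) hdm).trans (mul_comm _ _).le)
  have e2 : ∫⁻ x, ‖f x‖ₑ ^ (n + 1) ≤
      ENNReal.ofReal a * (∫⁻ x, (‖f x‖ₑ ^ n) ^ 2) ^ (1 / 2 : ℝ) := by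
    rw [← hN, mul_comm]
    simp_rw [pow_succ]
    exact cs _ _ (hfm.pow_const n) hfm
  have hβ : 0 < 1 - β := by linarith
  calc _ ≤ _ := add_le_add (mul_le_mul_right e1 _) (mul_le_mul_right e2 _)
    _ = _ := by
      rw [← mul_assoc, ← mul_assoc, ← add_mul, ← ENNReal.ofReal_mul (by positivity),
        ← ENNReal.ofReal_mul (by positivity), ← ENNReal.ofReal_add (by positivity) (by positivity)]
      congr 2
      have i1 : (a / b) ^ (1 - β) * b = a ^ (1 - β) * b ^ β := by
        rw [Real.div_rpow ha.le hb.le, Real.rpow_sub hb, Real.rpow_one]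
        have := Real.rpow_pos_of_pos hb β
        field_simp
      have i2 : (a / b) ^ (-β) * a = a ^ (1 - β) * b ^ β := by
        rw [Real.div_rpow ha.le hb.le, Real.rpow_sub ha, Real.rpow_one, Real.rpow_neg ha.le,
          Real.rpow_neg hb.le]
        have := Real.rpow_pos_of_pos hb β
        have := Real.rpow_pos_of_pos ha β
        field_simp
      linear_combination 2 / (1 - β) * (n + 1) * i1 + i2

lemma interp (u v : (Fin 3 → ℝ) → ℝ≥0∞) (hu : Measurable u) (hv : Measurable v) (l A B : ℝ)
    (hl0 : 0 ≤ l) (hl1 : l ≤ 1) (hA : 0 < A) (hB : 0 < B)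
    (h1 : ∫⁻ x, u x ≤ ENNReal.ofReal A) (h2 : ∫⁻ x, v x ≤ ENNReal.ofReal B) :
    ∫⁻ x, u x ^ l * v x ^ (1 - l) ≤ ENNReal.ofReal (A ^ l * B ^ (1 - l)) := by
  refine (ENNReal.lintegral_mul_norm_pow_le hu.aemeasurable hv.aemeasurable hl0
    (by linarith : (0 : ℝ) ≤ 1 - l) (by ring)).trans ?_
  rw [ENNReal.ofReal_mul (by positivity), ← ENNReal.ofReal_rpow_of_pos hA,
    ← ENNReal.ofReal_rpow_of_pos hB]
  exact mul_le_mul' (ENNReal.rpow_le_rpow h1 hl0) (ENNReal.rpow_le_rpow h2 (by linarith))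

lemma ptwise (y z α q β γ l : ℝ) (m k : ℕ) (hα : 0 < α) (hq : 0 < q)
    (hl0 : 0 ≤ l) (hl1 : l ≤ 1)
    (e1 : m * l + k * (1 - l) = q) (e2 : β * l + γ * (1 - l) = α * q) :
    ‖y / |z| ^ α‖ₑ ^ q ≤ (‖y‖ₑ ^ m * ENNReal.ofReal (|z| ^ (-β))) ^ l *
      (‖y‖ₑ ^ k * ENNReal.ofReal (|z| ^ (-γ))) ^ (1 - l) := by
  rcases eq_or_ne z 0 with rfl | hz
  · simp [Real.zero_rpow hα.ne', ENNReal.zero_rpow_of_pos hq]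
  rcases eq_or_ne y 0 with rfl | hy
  · simp [ENNReal.zero_rpow_of_pos hq]
  have hz' : 0 < |z| := abs_pos.2 hz
  have hy' : 0 < |y| := abs_pos.2 hy
  have t1 : ‖y‖ₑ = ENNReal.ofReal |y| := by rw [← Real.norm_eq_abs, ofReal_norm]
  have t2 : ‖y / |z| ^ α‖ₑ = ENNReal.ofReal (|y| / |z| ^ α) := by
    rw [← ofReal_norm, Real.norm_eq_abs, abs_div, abs_of_pos (Real.rpow_pos_of_pos hz' α)]
  rw [t1, t2, ← ENNReal.ofReal_pow hy'.le, ← ENNReal.ofReal_pow hy'.le,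
    ← ENNReal.ofReal_mul (by positivity), ← ENNReal.ofReal_mul (by positivity),
    ENNReal.ofReal_rpow_of_pos (by positivity), ENNReal.ofReal_rpow_of_pos (by positivity),
    ENNReal.ofReal_rpow_of_pos (by positivity), ← ENNReal.ofReal_mul (by positivity)]
  apply le_of_eq
  congr 1
  rw [Real.div_rpow hy'.le (by positivity), Real.mul_rpow (by positivity) (by positivity),
    Real.mul_rpow (by positivity) (by positivity), ← Real.rpow_natCast, ← Real.rpow_natCast,
    ← Real.rpow_mul hy'.le, ← Real.rpow_mul hy'.le, ← Real.rpow_mul hz'.le,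
    ← Real.rpow_mul hz'.le, ← Real.rpow_mul hz'.le, mul_mul_mul_comm, ← Real.rpow_add hy',
    ← Real.rpow_add hz', e1, show -β * l + -γ * (1 - l) = -(α * q) by linarith,
    Real.rpow_neg hz'.le]
  rfl

lemma sobolev6 : ∃ S : ℝ, 0 < S ∧ ∀ f : (Fin 3 → ℝ) → ℝ, ContDiff ℝ 1 f → HasCompactSupport f →
    eLpNorm f 6 volume ≤ ENNReal.ofReal S * eLpNorm (fderiv ℝ f) 2 volume := by
  refine ⟨SNormLESNormFDerivOfEqConst ℝ (volume : Measure (Fin 3 → ℝ)) 2 + 1, by positivity,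
    fun f hf hc => ?_⟩
  have := eLpNorm_le_eLpNorm_fderiv_of_eq (volume : Measure (Fin 3 → ℝ)) hf hc
    (p := 2) (p' := 6) (by norm_num) (by simp) (by simp; norm_num)
  refine (by simpa using this : _ ≤ _).trans (mul_le_mul' ?_ le_rfl)
  rw [← ENNReal.ofReal_coe_nnreal]
  exact ENNReal.ofReal_le_ofReal (by simp)

lemma six_form (f : (Fin 3 → ℝ) → ℝ) (c : ℝ) (hc : 0 < c)
    (h : eLpNorm f 6 volume ≤ ENNReal.ofReal c) :
    ∫⁻ x, ‖f x‖ₑ ^ 6 ≤ ENNReal.ofReal (c ^ 6) := by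
  rw [eLpNorm_eq_lintegral_rpow_enorm_toReal (by norm_num) (by norm_num)] at h
  have h' := ENNReal.rpow_le_rpow h (by norm_num : (0 : ℝ) ≤ 6)
  rw [← ENNReal.rpow_mul, ENNReal.ofReal_rpow_of_pos hc] at h'
  norm_num at h'
  exact_mod_cast h'

lemma comb (k₁ k₂ a b x₁ y₁ x₂ y₂ l X Y : ℝ) (h₁ : 0 < k₁) (h₂ : 0 < k₂) (ha : 0 < a) (hb : 0 < b)
    (hX : x₁ * l + x₂ * (1 - l) = X) (hY : y₁ * l + y₂ * (1 - l) = Y) :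
    (k₁ * (a ^ x₁ * b ^ y₁)) ^ l * (k₂ * (a ^ x₂ * b ^ y₂)) ^ (1 - l) =
      k₁ ^ l * k₂ ^ (1 - l) * (a ^ X * b ^ Y) := by
  rw [Real.mul_rpow h₁.le (by positivity), Real.mul_rpow h₂.le (by positivity),
    Real.mul_rpow (by positivity) (by positivity), Real.mul_rpow (by positivity) (by positivity),
    ← Real.rpow_mul ha.le, ← Real.rpow_mul ha.le, ← Real.rpow_mul hb.le, ← Real.rpow_mul hb.le,
    ← hX, ← hY, Real.rpow_add ha, Real.rpow_add hb]
  ring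

lemma core (α q S : ℝ) (hα0 : 0 < α) (hα : α < 1 / 4) (hq : 2 < q) (hq6 : q * (1 + 2 * α) < 6)
    (hS : 0 < S) :
    ∃ K : ℝ, 0 < K ∧ ∀ f : (Fin 3 → ℝ) → ℝ, ContDiff ℝ 1 f → HasCompactSupport f →
      ∀ a b : ℝ, 0 < a → 0 < b →
      (∫⁻ x, ‖f x‖ₑ ^ 2) ^ (1 / 2 : ℝ) = ENNReal.ofReal a →
      (∫⁻ x, ‖fderiv ℝ f x‖ₑ ^ 2) ^ (1 / 2 : ℝ) = ENNReal.ofReal b →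
      ∫⁻ x, ‖f x‖ₑ ^ 6 ≤ ENNReal.ofReal ((S * b) ^ 6) →
      ∫⁻ x, ‖f x / |x 2| ^ α‖ₑ ^ q ≤
        ENNReal.ofReal (K * (a ^ (q - (α * q + 3 * (q - 2) / 2)) *
          b ^ (α * q + 3 * (q - 2) / 2))) := by
  have four : ∀ β, 0 ≤ β → β < 1 → ∀ f : (Fin 3 → ℝ) → ℝ, ContDiff ℝ 1 f → HasCompactSupport f →
      ∀ a b : ℝ, 0 < a → 0 < b →
      (∫⁻ x, ‖f x‖ₑ ^ 2) ^ (1 / 2 : ℝ) = ENNReal.ofReal a →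
      (∫⁻ x, ‖fderiv ℝ f x‖ₑ ^ 2) ^ (1 / 2 : ℝ) = ENNReal.ofReal b →
      ∫⁻ x, ‖f x‖ₑ ^ 6 ≤ ENNReal.ofReal ((S * b) ^ 6) →
      ∫⁻ x, ‖f x‖ₑ ^ 4 * ENNReal.ofReal (|x 2| ^ (-β)) ≤
        ENNReal.ofReal (((2 / (1 - β) * 4 + 1) * S ^ 3) * (a ^ (1 - β) * b ^ (3 + β))) := by
    intro β h0 h1 f hf hc a b ha hb hN hD h6
    have hβ : 0 < 1 - β := by linarith
    have w := weighted β h0 h1 3 f hf hc a b ha hb hN hD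
    refine w.trans ?_
    have : (∫⁻ x, (‖f x‖ₑ ^ 3) ^ 2) ^ (1 / 2 : ℝ) ≤ ENNReal.ofReal ((S * b) ^ 3) := by
      simp_rw [← pow_mul]
      refine (ENNReal.rpow_le_rpow h6 (by norm_num)).trans ?_
      rw [ENNReal.ofReal_rpow_of_pos (by positivity)]
      apply le_of_eq
      congr 1
      rw [← Real.sqrt_eq_rpow, show (S * b) ^ 6 = ((S * b) ^ 3) ^ 2 by ring,
        Real.sqrt_sq (by positivity)]
    refine (mul_le_mul' le_rfl this).trans ?_
    rw [← ENNReal.ofReal_mul (by positivity)]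
    apply le_of_eq
    congr 1
    rw [Real.rpow_add hb, show b ^ (3 : ℝ) = b ^ 3 by exact_mod_cast Real.rpow_natCast b 3]
    push_cast
    ring
  by_cases h4 : q ≤ 4
  · have hβ1 : α * q < 1 := by nlinarith
    have hβ : 0 < 1 - α * q := by linarith
    have hβ0 : 0 < α * q := by positivity
    refine ⟨(2 / (1 - α * q) * 2 + 1) ^ ((4 - q) / 2) *
      ((2 / (1 - α * q) * 4 + 1) * S ^ 3) ^ (1 - (4 - q) / 2), by positivity, ?_⟩
    intro f hf hc a b ha hb hN hD h6
    have hfm : Measurable (fun x => ‖f x‖ₑ) := hf.continuous.enorm.measurable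
    have hwm : Measurable (fun x : Fin 3 → ℝ => ENNReal.ofReal (|x 2| ^ (-(α * q)))) := by
      fun_prop
    have B := four (α * q) hβ0.le hβ1 f hf hc a b ha hb hN hD h6
    have A := weighted (α * q) hβ0.le hβ1 1 f hf hc a b ha hb hN hD
    simp only [pow_one] at A
    rw [hN, ← ENNReal.ofReal_mul (by positivity)] at A
    have I := interp _ _ ((hfm.pow_const 2).mul hwm) ((hfm.pow_const 4).mul hwm) ((4 - q) / 2)
      _ _ (by linarith) (by linarith) (by positivity) (by positivity) A B
    refine (lintegral_mono fun x => ptwise (f x) (x 2) α q (α * q) (α * q) ((4 - q) / 2) 2 4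
      hα0 (by linarith) (by linarith) (by linarith) (by push_cast; ring) (by ring)).trans
      (I.trans (le_of_eq ?_))
    congr 1
    rw [show ((2 / (1 - α * q) * ((1 : ℕ) + 1) + 1) * (a ^ (1 - α * q) * b ^ (α * q)) * a) =
      (2 / (1 - α * q) * 2 + 1) * (a ^ (2 - α * q) * b ^ (α * q)) by
        rw [show 2 - α * q = (1 - α * q) + 1 by ring, Real.rpow_add ha, Real.rpow_one]
        push_cast; ring]
    exact comb _ _ a b _ _ _ _ _ _ _ (by positivity) (by positivity) ha hb (by ring) (by ring)
  · push Not at h4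
    have h6q : 0 < 6 - q := by nlinarith
    obtain ⟨β, hβd⟩ : ∃ β, β = 2 * α * q / (6 - q) := ⟨_, rfl⟩
    have hβq : β * (6 - q) = 2 * α * q := by rw [hβd]; field_simp
    have hβ1 : β < 1 := by rw [hβd, div_lt_one h6q]; linarith
    have hβ0 : 0 < β := by rw [hβd]; positivity
    have hβ : 0 < 1 - β := by linarith
    refine ⟨((2 / (1 - β) * 4 + 1) * S ^ 3) ^ ((6 - q) / 2) * (S ^ 6) ^ (1 - (6 - q) / 2),
      by positivity, ?_⟩
    intro f hf hc a b ha hb hN hD h6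
    have hfm : Measurable (fun x => ‖f x‖ₑ) := hf.continuous.enorm.measurable
    have hwm : Measurable (fun x : Fin 3 → ℝ => ENNReal.ofReal (|x 2| ^ (-β))) := by
      fun_prop
    have hwm0 : Measurable (fun x : Fin 3 → ℝ => ENNReal.ofReal (|x 2| ^ (-(0 : ℝ)))) := by
      fun_prop
    have A := four β hβ0.le hβ1 f hf hc a b ha hb hN hD h6
    have B : ∫⁻ x, ‖f x‖ₑ ^ 6 * ENNReal.ofReal (|x 2| ^ (-(0 : ℝ))) ≤
        ENNReal.ofReal ((S * b) ^ 6) := by simpa using h6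
    have I := interp _ _ ((hfm.pow_const 4).mul hwm) ((hfm.pow_const 6).mul hwm0) ((6 - q) / 2)
      _ _ (by linarith) (by linarith) (by positivity) (by positivity) A B
    refine (lintegral_mono fun x => ptwise (f x) (x 2) α q β 0 ((6 - q) / 2) 4 6
      hα0 (by linarith) (by linarith) (by linarith) (by push_cast; ring) (by linarith)).trans
      (I.trans (le_of_eq ?_))
    congr 1
    rw [show (S * b) ^ 6 = S ^ 6 * (a ^ (0 : ℝ) * b ^ (6 : ℝ)) by
      rw [show b ^ (6 : ℝ) = b ^ 6 by exact_mod_cast Real.rpow_natCast b 6, Real.rpow_zero]; ring]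
    exact comb _ _ a b _ _ _ _ _ _ _ (by positivity) (by positivity) ha hb
      (by linarith) (by linarith)

/-- **Hardy–Sobolev + Gagliardo–Nirenberg estimate with the weight `|x_3|^{-α}`.**
For `0 < α < 1/4` and `3/(1−α) < p < ∞`, one has, for all `f ∈ C_0^∞(ℝ³)`,
`‖ f/|x_3|^α ‖_{L^{2p/(p−2)}(ℝ³)} ≤ C ‖f‖_{L²}^{(p−3−pα)/p} ‖∇f‖_{L²}^{(3+pα)/p}`. -/
theorem hardy_sobolev_GN_x3_weight
    (α p : ℝ) (hα0 : 0 < α) (hα : α < 1 / 4) (hp : 3 / (1 - α) < p) :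
    ∃ C : ℝ, 0 < C ∧ ∀ f : (Fin 3 → ℝ) → ℝ,
      ContDiff ℝ (⊤ : ℕ∞) f → HasCompactSupport f →
      eLpNorm (fun x => f x / |x 2| ^ α) (ENNReal.ofReal (2 * p / (p - 2))) volume
        ≤ ENNReal.ofReal C *
          (eLpNorm f 2 volume ^ ((p - 3 - p * α) / p) *
            eLpNorm (fderiv ℝ f) 2 volume ^ ((3 + p * α) / p)) := by
  have hp' : 3 < p * (1 - α) := by rwa [div_lt_iff₀ (by linarith)] at hp
  have hp3 : 3 < p := by nlinarith
  have hp2 : 0 < p - 2 := by linarith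
  obtain ⟨q, hqd⟩ : ∃ q, q = 2 * p / (p - 2) := ⟨_, rfl⟩
  have hqp : q * (p - 2) = 2 * p := by rw [hqd]; field_simp
  have hq2 : 2 < q := by rw [hqd, lt_div_iff₀ hp2]; linarith
  have hq6 : q * (1 + 2 * α) < 6 := by
    rw [hqd, div_mul_eq_mul_div, div_lt_iff₀ hp2]; nlinarith
  rw [← hqd]
  obtain ⟨S, hS, sob⟩ := sobolev6
  obtain ⟨K, hK, H⟩ := core α q S hα0 hα hq2 hq6 hS
  refine ⟨K ^ (1 / q), by positivity, fun f hf hc => ?_⟩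
  have hf1 : ContDiff ℝ 1 f := hf.of_le (by exact_mod_cast le_top)
  have hq0 : 0 < q := by linarith
  have two : ∀ {E : Type} [NormedAddCommGroup E] (g : (Fin 3 → ℝ) → E),
      eLpNorm g 2 volume = (∫⁻ x, ‖g x‖ₑ ^ 2) ^ (1 / 2 : ℝ) := by
    intro E _ g
    rw [eLpNorm_eq_lintegral_rpow_enorm_toReal (by norm_num) (by norm_num)]
    simp
  have hNfin : eLpNorm f 2 volume ≠ ∞ := (hf.continuous.memLp_of_hasCompactSupport hc).2.ne
  have hDfin : eLpNorm (fderiv ℝ f) 2 volume ≠ ∞ :=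
    ((hf1.continuous_fderiv one_ne_zero).memLp_of_hasCompactSupport (hc.fderiv ℝ)).2.ne
  have zero : ∀ r : ℝ≥0∞, r ≠ 0 → eLpNorm f r volume = 0 →
      eLpNorm (fun x => f x / |x 2| ^ α) (ENNReal.ofReal q) volume = 0 := by
    intro r hr h
    have h0 := (eLpNorm_eq_zero_iff hf.continuous.aestronglyMeasurable hr).1 h
    rw [← eLpNorm_zero (ε := ℝ) (p := ENNReal.ofReal q) (μ := (volume : Measure (Fin 3 → ℝ)))]
    refine eLpNorm_congr_ae ?_
    filter_upwards [h0] with x hx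
    simp [hx]
  by_cases hN0 : eLpNorm f 2 volume = 0
  · rw [zero 2 (by norm_num) hN0]; exact zero_le
  have s6 := sob f hf1 hc
  by_cases hD0 : eLpNorm (fderiv ℝ f) 2 volume = 0
  · rw [hD0, mul_zero] at s6
    rw [zero 6 (by norm_num) (le_antisymm s6 zero_le)]; exact zero_le
  obtain ⟨a, had⟩ : ∃ a, a = (eLpNorm f 2 volume).toReal := ⟨_, rfl⟩
  obtain ⟨b, hbd⟩ : ∃ b, b = (eLpNorm (fderiv ℝ f) 2 volume).toReal := ⟨_, rfl⟩
  have ha : 0 < a := had ▸ ENNReal.toReal_pos hN0 hNfin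
  have hb : 0 < b := hbd ▸ ENNReal.toReal_pos hD0 hDfin
  have hN : eLpNorm f 2 volume = ENNReal.ofReal a := by rw [had, ENNReal.ofReal_toReal hNfin]
  have hD : eLpNorm (fderiv ℝ f) 2 volume = ENNReal.ofReal b := by
    rw [hbd, ENNReal.ofReal_toReal hDfin]
  rw [hD, ← ENNReal.ofReal_mul hS.le] at s6
  have main := H f hf1 hc a b ha hb (by rw [← two, hN]) (by rw [← two, hD])
    (six_form f _ (by positivity) s6)
  rw [hN, hD, eLpNorm_eq_lintegral_rpow_enorm_toReal (by simpa using hq0) (by simp),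
    ENNReal.toReal_ofReal hq0.le]
  refine (ENNReal.rpow_le_rpow main (by positivity)).trans (le_of_eq ?_)
  rw [ENNReal.ofReal_rpow_of_pos (by positivity), ENNReal.ofReal_rpow_of_pos ha,
    ENNReal.ofReal_rpow_of_pos hb, ← ENNReal.ofReal_mul (by positivity),
    ← ENNReal.ofReal_mul (by positivity)]
  congr 1
  rw [Real.mul_rpow (by positivity) (by positivity), Real.mul_rpow (by positivity) (by positivity),
    ← Real.rpow_mul ha.le, ← Real.rpow_mul hb.le]
  have hp0 : 0 < p := by linarith
  have e : (α * q + 3 * (q - 2) / 2) * (1 / q) = (3 + p * α) / p := by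
    field_simp
    linear_combination 3 * hqp
  congr 3
  rw [sub_mul, e]
  field_simp
  ring
end
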